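/- arXiv:1405.0771 — 3 statements merged into one kernel-verified Lean document; each statement's English description precedes it below -/
import Mathlib

section
/- (Handel–Mosher) For every integer N ≥ 2 there exists a finite constant C_N such that for every fully irreducible outer automorphism φ ∈ Out(F_N) of the free group F_N of rank N one has log(λ(φ)) ≤ C_N · log(λ(φ⁻¹)); equivalently, the supremum of log(λ(φ))/log(λ(φ⁻¹)) over all fully irreducible φ ∈ Out(F_N) is finite. -/
/-- The free group of rank `N`. -/
abbrev FreeGroupN (N : ℕ) := FreeGroup (Fin N)

/-- The subgroup of inner automorphisms of a group `G`. -/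
def Inn (G : Type*) [Group G] : Subgroup (MulAut G) :=
  (MulAut.conj : G →* MulAut G).range

instance Inn.normal (G : Type*) [Group G] : (Inn G).Normal := by
  constructor
  rintro _ ⟨g, rfl⟩ f
  refine ⟨f g, ?_⟩
  ext x
  simp [MulAut.conj, mul_assoc]

/-- The outer automorphism group `Out(G) = Aut(G)/Inn(G)`. -/
def Out (G : Type*) [Group G] := MulAut G ⧸ Inn G

instance (G : Type*) [Group G] : Group (Out G) :=
  inferInstanceAs (Group (MulAut G ⧸ Inn G))

/-- A subgroup `A ≤ G` is a free factor if there is a subgroup `B ≤ G` such that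
`G` is the internal free product `A * B`, i.e. the natural map from the (external)
free product `A ∗ B` to `G` is an isomorphism. -/
def IsFreeFactor {G : Type*} [Group G] (A : Subgroup G) : Prop :=
  ∃ B : Subgroup G, Function.Bijective (Monoid.Coprod.lift A.subtype B.subtype)

/-- An outer automorphism is fully irreducible if no positive power preserves the
conjugacy class of a proper nontrivial free factor. -/
def FullyIrreducible {N : ℕ} (φ : Out (FreeGroupN N)) : Prop :=
  ∀ k : ℕ, 0 < k →
    ∀ f : MulAut (FreeGroupN N), (QuotientGroup.mk f : Out (FreeGroupN N)) = φ ^ k →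
      ∀ A : Subgroup (FreeGroupN N), IsFreeFactor A → A ≠ ⊥ → A ≠ ⊤ →
        ∀ g : FreeGroupN N,
          A.map (f : FreeGroupN N →* FreeGroupN N) ≠
            A.map ((MulAut.conj g : MulAut (FreeGroupN N)) : FreeGroupN N →* FreeGroupN N)

/-- The cyclically reduced length of a conjugacy class `α` with respect to a
free basis of `F_N` (encoded as a group isomorphism `β` with the standard free
group of rank `N`): the minimal word length among representatives of `α`. -/
noncomputable def cycLength {N : ℕ} (β : FreeGroupN N ≃* FreeGroup (Fin N))
    (α : ConjClasses (FreeGroupN N)) : ℕ :=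
  sInf ((fun g => (β g).norm) '' {g : FreeGroupN N | ConjClasses.mk g = α})

/-- A conjugacy class `α` is periodic for an automorphism `f` if some positive power
of `f` fixes `α`. -/
def IsPeriodicClass {N : ℕ} (f : MulAut (FreeGroupN N)) (α : ConjClasses (FreeGroupN N)) : Prop :=
  ∃ k : ℕ, 0 < k ∧ ConjClasses.map ((f ^ k : MulAut (FreeGroupN N)) : FreeGroupN N →* FreeGroupN N) α = α

/-- `lam` is the stretch factor of the outer automorphism `φ`: for every automorphism `f`
representing `φ`, every free basis of `F_N` and every non-`φ`-periodic conjugacy class `α`,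
the sequence `n ↦ ‖φ^n(α)‖_X^(1/n)` converges to `lam`. -/
def HasStretchFactor {N : ℕ} (φ : Out (FreeGroupN N)) (lam : ℝ) : Prop :=
  ∀ f : MulAut (FreeGroupN N), (QuotientGroup.mk f : Out (FreeGroupN N)) = φ →
    ∀ β : FreeGroupN N ≃* FreeGroup (Fin N),
      ∀ α : ConjClasses (FreeGroupN N), ¬ IsPeriodicClass f α →
        Filter.Tendsto
          (fun n : ℕ =>
            ((cycLength β (ConjClasses.map ((f ^ n : MulAut (FreeGroupN N)) : FreeGroupN N →* FreeGroupN N) α) : ℝ)) ^ (1 / (n : ℝ)))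
          Filter.atTop (nhds lam)

namespace FreeGroup

variable {α : Type*} [DecidableEq α]

theorem norm_pow_of_isCyclicallyReduced {g : FreeGroup α}
    (hg : IsCyclicallyReduced g.toWord) (n : ℕ) : (g ^ n).norm = n * g.norm := by
  rw [norm, toWord_pow, (hg.flatten_replicate n).isReduced.reduce_eq]
  simp [norm]

theorem norm_pow_le (g : FreeGroup α) (n : ℕ) : (g ^ n).norm ≤ n * g.norm := by
  induction n with
  | zero => simp
  | succ n ih =>
    rw [pow_succ, Nat.succ_mul]
    exact (norm_mul_le _ _).trans (by omega)

/-- Cyclically reduced words have minimal norm in their conjugacy class. -/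
theorem norm_le_norm_conj_of_isCyclicallyReduced {g : FreeGroup α}
    (hg : IsCyclicallyReduced g.toWord) (c : FreeGroup α) : g.norm ≤ (c * g * c⁻¹).norm := by
  by_contra! h
  set k := c * g * c⁻¹ with hk
  have h1 := norm_pow_of_isCyclicallyReduced hg (2 * c.norm + 1)
  have h2 : g ^ (2 * c.norm + 1) = c⁻¹ * k ^ (2 * c.norm + 1) * c := by
    rw [hk, conj_pow]; group
  have h3 := norm_mul_le (c⁻¹ * k ^ (2 * c.norm + 1)) c
  have h4 := norm_mul_le c⁻¹ (k ^ (2 * c.norm + 1))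
  have h5 := norm_pow_le k (2 * c.norm + 1)
  rw [norm_inv_eq] at h4
  rw [← h2, h1] at h3
  nlinarith

theorem exists_toWord_eq_of_norm_conj_lt {g : FreeGroup α} (c : FreeGroup α)
    (h : (c * g * c⁻¹).norm < g.norm) :
    ∃ (s : α × Bool) (L : List (α × Bool)), g.toWord = s :: L ++ [(s.1, !s.2)] := by
  have hg : ¬ IsCyclicallyReduced g.toWord := fun hg =>
    absurd (norm_le_norm_conj_of_isCyclicallyReduced hg c) (by omega)
  have hr : IsReduced g.toWord := isReduced_toWord
  generalize g.toWord = W at hg hr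
  induction W using List.bidirectionalRec with
  | nil => simp at hg
  | singleton a => simp at hg
  | cons_append a l b _ =>
    rw [← List.cons_append, isCyclicallyReduced_cons_append_iff] at hg
    refine ⟨a, l, ?_⟩
    have : ¬ (b.1 = a.1 → b.2 = a.2) := fun h => hg ⟨hr, h⟩
    push Not at this
    have hb : b = (a.1, !a.2) := Prod.ext this.1 (by
      have := this.2; revert this; cases b.2 <;> cases a.2 <;> simp)
    rw [hb]; simp

theorem norm_conj_of_toWord_eq {g : FreeGroup α} {s : α × Bool} {L : List (α × Bool)}
    (h : g.toWord = s :: L ++ [(s.1, !s.2)]) :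
    ((mk [s])⁻¹ * g * mk [s]).norm + 2 ≤ g.norm := by
  have h1 : g = mk [s] * mk L * (mk [s])⁻¹ := by
    rw [← mk_toWord (x := g), h, inv_mk, mul_mk, mul_mk]
    simp [invRev]
  have h2 : (mk [s])⁻¹ * g * mk [s] = mk L := by rw [h1]; group
  have h3 : g.norm = L.length + 2 := by rw [norm, h]; simp
  rw [h2, h3]
  have := norm_mk_le (L₁ := L)
  omega

theorem toWord_mul_of_ends_ne {g h : FreeGroup α} {s t : α × Bool} {L M : List (α × Bool)}
    (hg : g.toWord = s :: L ++ [(s.1, !s.2)]) (hh : h.toWord = t :: M ++ [(t.1, !t.2)])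
    (hst : s ≠ t) : IsCyclicallyReduced (g * h).toWord ∧ (g * h).norm = g.norm + h.norm := by
  have key : ∀ s t : α × Bool, s ≠ t → s.1 = t.1 → (!s.2) = t.2 := by
    rintro ⟨a, b⟩ ⟨c, d⟩ h h'
    simp only at h'
    subst h'
    cases b <;> cases d <;> simp_all
  have hred : IsReduced (g.toWord ++ h.toWord) := by
    have h1 : IsReduced g.toWord := isReduced_toWord
    have h2 : IsReduced h.toWord := isReduced_toWord
    refine List.isChain_append.2 ⟨h1, h2, ?_⟩
    intro x hx y hy
    rw [hg, List.getLast?_concat] at hx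
    rw [hh] at hy
    simp only [Option.mem_def, Option.some.injEq, List.cons_append, List.head?_cons] at hx hy
    subst hx hy
    exact key s t hst
  have hw : (g * h).toWord = g.toWord ++ h.toWord := by rw [toWord_mul, hred.reduce_eq]
  refine ⟨?_, by simp [norm, hw]⟩
  rw [hw, isCyclicallyReduced_iff]
  refine ⟨hred, ?_⟩
  intro x hx y hy
  rw [hh, ← List.append_assoc, List.getLast?_concat] at hx
  rw [hg] at hy
  simp only [Option.mem_def, Option.some.injEq, List.cons_append, List.head?_cons] at hx hy
  subst hx hy
  exact key t s hst.symm

/-- If finitely many elements and their pairwise products have short conjugates, then the elements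
can be made short by one simultaneous conjugation. -/
theorem exists_forall_norm_conj_le {ι : Type*} (K : ℕ) (m : ℕ) :
    ∀ a : ι → FreeGroup α, (∀ i, ∃ c : FreeGroup α, (c * a i * c⁻¹).norm ≤ K) →
      (∀ i j, ∃ c : FreeGroup α, (c * (a i * a j) * c⁻¹).norm ≤ K) → (∀ i, (a i).norm ≤ m) →
      ∃ c : FreeGroup α, ∀ i, (c * a i * c⁻¹).norm ≤ K + 2 := by
  induction m with
  | zero => exact fun a _ _ h => ⟨1, fun i => by simpa using (h i).trans (by omega)⟩
  | succ m ih =>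
    intro a h1 h2 h3
    by_cases hm : m + 1 ≤ K + 2
    · exact ⟨1, fun i => by simpa using (h3 i).trans hm⟩
    by_cases hall : ∀ i, (a i).norm ≤ m
    · exact ih a h1 h2 hall
    push Not at hall
    obtain ⟨i, hi⟩ := hall
    obtain ⟨c, hc⟩ := h1 i
    obtain ⟨s, L, hs⟩ := exists_toWord_eq_of_norm_conj_lt c (g := a i) (by omega)
    have hshort : ∀ j, ((mk [s])⁻¹ * a j * mk [s]).norm ≤ m := by
      intro j
      by_contra! hj
      have hj1 := norm_mul_le ((mk [s])⁻¹ * a j) (mk [s])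
      have hj2 := norm_mul_le (mk [s])⁻¹ (a j)
      have hj3 : (mk [s]).norm ≤ 1 := norm_mk_le
      rw [norm_inv_eq] at hj2
      obtain ⟨d, hd⟩ := h1 j
      obtain ⟨t, M, ht⟩ := exists_toWord_eq_of_norm_conj_lt d (g := a j) (by omega)
      by_cases hst : s = t
      · subst hst
        have := norm_conj_of_toWord_eq ht
        have := h3 j
        omega
      · obtain ⟨hcr, hn⟩ := toWord_mul_of_ends_ne hs ht hst
        obtain ⟨e, he⟩ := h2 i j
        have := norm_le_norm_conj_of_isCyclicallyReduced hcr e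
        omega
    obtain ⟨c', hc'⟩ := ih (fun j => (mk [s])⁻¹ * a j * mk [s])
      (fun j => by
        obtain ⟨d, hd⟩ := h1 j
        refine ⟨d * mk [s], ?_⟩
        convert hd using 2
        group)
      (fun j k => by
        obtain ⟨d, hd⟩ := h2 j k
        refine ⟨d * mk [s], ?_⟩
        convert hd using 2
        group) hshort
    refine ⟨c' * (mk [s])⁻¹, fun j => ?_⟩
    convert hc' j using 2
    group

end FreeGroup

theorem MvPolynomial.finrank_restrictDegree (σ K : Type*) [Fintype σ] [Field K] (m : ℕ) :
    Module.Finite K (MvPolynomial.restrictDegree σ K m) ∧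
      Module.finrank K (MvPolynomial.restrictDegree σ K m) = (m + 1) ^ Fintype.card σ := by
  classical
  let e : {n : σ →₀ ℕ | ∀ i, n i ≤ m} ≃ (σ → Fin (m + 1)) :=
    { toFun := fun n i => ⟨n.1 i, Nat.lt_succ_of_le (n.2 i)⟩
      invFun := fun g => ⟨Finsupp.equivFunOnFinite.symm fun i => (g i : ℕ),
        fun i => Nat.le_of_lt_succ (g i).2⟩
      left_inv := fun n => by ext; simp
      right_inv := fun g => by ext; simp }
  let b := (MvPolynomial.basisRestrictSupport K {n : σ →₀ ℕ | ∀ i, n i ≤ m}).reindex e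
  refine ⟨Module.Finite.of_basis b, ?_⟩
  rw [show Module.finrank K (MvPolynomial.restrictDegree σ K m) = _ from
    Module.finrank_eq_card_basis b]
  simp

/-- A degree-like function bounds the degree of a polynomial expression. -/
theorem MvPolynomial.deg_aeval_le {σ K R : Type*} [Fintype σ] [CommSemiring K] [CommSemiring R]
    [Algebra K R] (deg : R → ℕ) (hadd : ∀ a b, deg (a + b) ≤ max (deg a) (deg b))
    (hmul : ∀ a b, deg (a * b) ≤ deg a + deg b) (hK : ∀ c : K, deg (algebraMap K R c) = 0)
    {E : σ → R} {L D : ℕ} (hE : ∀ s, deg (E s) ≤ L) {q : MvPolynomial σ K}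
    (hq : q ∈ MvPolynomial.restrictDegree σ K D) :
    deg (MvPolynomial.aeval E q) ≤ Fintype.card σ * (D * L) := by
  classical
  have hone : deg 1 = 0 := by simpa using hK 1
  have hzero : deg 0 = 0 := by simpa using hK 0
  have hpow : ∀ a k, deg (a ^ k) ≤ k * deg a := by
    intro a k
    induction k with
    | zero => simp [hone]
    | succ k ih => rw [pow_succ, Nat.succ_mul]; exact (hmul _ _).trans (by omega)
  have hprod : ∀ (s : Finset σ) (g : σ → R), deg (∏ i ∈ s, g i) ≤ ∑ i ∈ s, deg (g i) := by
    intro s g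
    induction s using Finset.induction with
    | empty => simp [hone]
    | insert a s ha ih =>
      rw [Finset.prod_insert ha, Finset.sum_insert ha]
      exact (hmul _ _).trans (by omega)
  rw [MvPolynomial.aeval_def, MvPolynomial.eval₂_eq']
  refine Finset.sum_induction _ (fun a => deg a ≤ Fintype.card σ * (D * L))
    (fun a b ha hb => (hadd a b).trans (max_le ha hb)) (by simp [hzero]) fun e he => ?_
  refine (hmul _ _).trans ?_
  rw [hK, zero_add]
  refine (hprod _ _).trans ?_
  refine (Finset.sum_le_card_nsmul _ _ (D * L) fun i _ => ?_).trans (by simp)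
  exact (hpow _ _).trans (Nat.mul_le_mul ((MvPolynomial.mem_restrictDegree _ q D).1 hq e he i)
    (hE i))

theorem Polynomial.eq_zero_of_sum_pow_mul_eq_zero {R : Type*} [CommRing R] [IsDomain R]
    {P : Polynomial R} : ∀ (k : ℕ) (r : Fin k → Polynomial R),
      (∀ j, (r j).natDegree < P.natDegree) → ∑ j : Fin k, P ^ (j : ℕ) * r j = 0 → ∀ j, r j = 0 := by
  intro k
  induction k with
  | zero => exact fun _ _ _ j => j.elim0
  | succ k ih =>
    intro r hr h
    have hP : P ≠ 0 := by
      rintro rfl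
      simpa using hr 0
    have hs : ∑ j : Fin (k + 1), P ^ (j : ℕ) * r j
        = r 0 + P * ∑ j : Fin k, P ^ (j : ℕ) * r j.succ := by
      rw [Fin.sum_univ_succ, Finset.mul_sum]
      simp [pow_succ', mul_assoc]
    rw [hs] at h
    have h0 : r 0 = 0 := by
      refine Polynomial.eq_zero_of_dvd_of_natDegree_lt ?_ (hr 0)
      exact ⟨-∑ j : Fin k, P ^ (j : ℕ) * r j.succ, by linear_combination h⟩
    rw [h0, zero_add, mul_eq_zero, or_iff_right hP] at h
    intro j
    refine Fin.cases h0 (fun j => ih (fun j => r j.succ) (fun j => hr _) h j) j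

section BruhatRep

open Matrix MatrixGroups

/-- The product of a lower, an upper and a lower unipotent matrix. -/
def bruhatMatrix {R : Type*} [CommRing R] (x y z : R) : SL(2, R) :=
  ⟨!![1 + y * z, y; x + z + x * y * z, 1 + x * y], by rw [Matrix.det_fin_two_of]; ring⟩

theorem coe_bruhatMatrix {R : Type*} [CommRing R] (x y z : R) :
    (bruhatMatrix x y z : Matrix (Fin 2) (Fin 2) R) =
      !![1 + y * z, y; x + z + x * y * z, 1 + x * y] := rfl

/-- The representation of a free group sending each generator to a `bruhatMatrix`. -/
def bruhatRep {ι R : Type*} [CommRing R] (p : ι → Fin 3 → R) : FreeGroup ι →* SL(2, R) :=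
  FreeGroup.lift fun i => bruhatMatrix (p i 0) (p i 1) (p i 2)

theorem bruhatRep_of {ι R : Type*} [CommRing R] (p : ι → Fin 3 → R) (i : ι) :
    bruhatRep p (FreeGroup.of i) = bruhatMatrix (p i 0) (p i 1) (p i 2) :=
  FreeGroup.lift_apply_of

theorem map_bruhatRep {ι R S : Type*} [CommRing R] [CommRing S] (θ : R →+* S) (p : ι → Fin 3 → R)
    (w : FreeGroup ι) :
    Matrix.SpecialLinearGroup.map θ (bruhatRep p w) = bruhatRep (fun i k => θ (p i k)) w := by
  have : (Matrix.SpecialLinearGroup.map θ).comp (bruhatRep p)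
      = bruhatRep (fun i k => θ (p i k)) := by
    refine FreeGroup.ext_hom _ _ fun i => ?_
    rw [MonoidHom.comp_apply, bruhatRep_of, bruhatRep_of]
    ext a b
    rw [Matrix.SpecialLinearGroup.map_apply_coe, RingHom.mapMatrix_apply, Matrix.map_apply,
      coe_bruhatMatrix, coe_bruhatMatrix]
    fin_cases a <;> fin_cases b <;> simp
  exact DFunLike.congr_fun this w

/-- A matrix of determinant one with nonzero upper right entry is a `bruhatMatrix`. -/
theorem bruhatMatrix_of_ne_zero {F : Type*} [Field F] (g : SL(2, F)) (hg : g 0 1 ≠ 0) :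
    bruhatMatrix ((g 1 1 - 1) / g 0 1) (g 0 1) ((g 0 0 - 1) / g 0 1) = g := by
  have hdet := g.det_coe
  rw [Matrix.det_fin_two] at hdet
  ext a b
  rw [coe_bruhatMatrix]
  fin_cases a <;> fin_cases b <;> simp <;> field_simp <;> try ring1
  linear_combination hdet

theorem bruhatRep_mk_true {ι R : Type*} [CommRing R] (p : ι → Fin 3 → R) (i : ι) :
    (bruhatRep p (FreeGroup.mk [(i, true)]) : Matrix (Fin 2) (Fin 2) R) =
      !![1 + p i 1 * p i 2, p i 1; p i 0 + p i 2 + p i 0 * p i 1 * p i 2, 1 + p i 0 * p i 1] := by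
  rw [← FreeGroup.of, bruhatRep_of, coe_bruhatMatrix]

theorem bruhatRep_mk_false {ι R : Type*} [CommRing R] (p : ι → Fin 3 → R) (i : ι) :
    (bruhatRep p (FreeGroup.mk [(i, false)]) : Matrix (Fin 2) (Fin 2) R) =
      !![1 + p i 0 * p i 1, - p i 1;
        - (p i 0 + p i 2 + p i 0 * p i 1 * p i 2), 1 + p i 1 * p i 2] := by
  have : FreeGroup.mk [(i, false)] = (FreeGroup.of i)⁻¹ := by
    rw [FreeGroup.of, FreeGroup.inv_mk]; rfl
  rw [this, map_inv, bruhatRep_of, Matrix.SpecialLinearGroup.coe_inv, coe_bruhatMatrix,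
    Matrix.adjugate_fin_two_of]

theorem bruhatRep_mk_cons {ι R : Type*} [CommRing R] (p : ι → Fin 3 → R) (s : ι × Bool)
    (l : List (ι × Bool)) (a b : Fin 2) :
    bruhatRep p (FreeGroup.mk (s :: l)) a b =
      bruhatRep p (FreeGroup.mk [s]) a 0 * bruhatRep p (FreeGroup.mk l) 0 b +
        bruhatRep p (FreeGroup.mk [s]) a 1 * bruhatRep p (FreeGroup.mk l) 1 b := by
  rw [← List.singleton_append, ← FreeGroup.mul_mk, map_mul, Matrix.SpecialLinearGroup.coe_mul,
    Matrix.mul_apply, Fin.sum_univ_two]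

theorem degreeOf_bruhatRep_le {ι : Type*} (s : ι × Fin 3) (w : FreeGroup ι) [DecidableEq ι]
    (a b : Fin 2) :
    (bruhatRep (fun i k => (MvPolynomial.X (i, k) : MvPolynomial (ι × Fin 3) ℚ)) w a b).degreeOf s
      ≤ w.norm := by
  have hX : ∀ t : ι × Fin 3, MvPolynomial.degreeOf s (MvPolynomial.X t : MvPolynomial _ ℚ)
      = if s = t then 1 else 0 := fun t => MvPolynomial.degreeOf_X s t
  have hneg : ∀ q : MvPolynomial (ι × Fin 3) ℚ, (-q).degreeOf s = q.degreeOf s := fun q => by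
    rw [MvPolynomial.degreeOf_def, MvPolynomial.degrees_neg, ← MvPolynomial.degreeOf_def]
  have h1 : ∀ q : MvPolynomial (ι × Fin 3) ℚ, q.degreeOf s ≤ 1 → (1 + q).degreeOf s ≤ 1 :=
    fun q hq => (MvPolynomial.degreeOf_add_le _ _ _).trans (by simp [hq])
  have h2 : ∀ (i : ι) (k l : Fin 3), k ≠ l → (MvPolynomial.X (i, k) * MvPolynomial.X (i, l) :
      MvPolynomial (ι × Fin 3) ℚ).degreeOf s ≤ 1 := fun i k l hkl =>
    (MvPolynomial.degreeOf_mul_le _ _ _).trans (by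
      rw [hX, hX]
      split_ifs with h h'
      · exact absurd (congrArg Prod.snd (h.symm.trans h')) hkl
      all_goals simp)
  have h3 : ∀ i : ι, (MvPolynomial.X (i, 0) + MvPolynomial.X (i, 2) + MvPolynomial.X (i, 0) *
      MvPolynomial.X (i, 1) * MvPolynomial.X (i, 2) :
      MvPolynomial (ι × Fin 3) ℚ).degreeOf s ≤ 1 := fun i => by
    refine (MvPolynomial.degreeOf_add_le _ _ _).trans (max_le ?_ ?_)
    · refine (MvPolynomial.degreeOf_add_le _ _ _).trans (max_le ?_ ?_) <;>
        rw [hX] <;> split_ifs <;> simp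
    · refine (MvPolynomial.degreeOf_mul_le _ _ _).trans ?_
      refine (add_le_add_left (MvPolynomial.degreeOf_mul_le _ _ _) _).trans ?_
      rw [hX, hX, hX]
      rcases s with ⟨j, k⟩
      by_cases hj : j = i
      · subst hj
        fin_cases k <;> simp
      · simp [hj]
  have h4 : ∀ (i : ι) (k : Fin 3), (MvPolynomial.X (i, k) :
      MvPolynomial (ι × Fin 3) ℚ).degreeOf s ≤ 1 := fun i k => by
    rw [hX]; split_ifs <;> simp
  have hletter : ∀ (t : ι × Bool) (a b : Fin 2), (bruhatRep (fun i k => (MvPolynomial.X (i, k) :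
      MvPolynomial (ι × Fin 3) ℚ)) (FreeGroup.mk [t]) a b).degreeOf s ≤ 1 := by
    rintro ⟨i, _ | _⟩ a b
    · rw [bruhatRep_mk_false]
      fin_cases a <;> fin_cases b
      · exact h1 _ (h2 i 0 1 (by decide))
      · exact (hneg _).trans_le (h4 i 1)
      · exact (hneg _).trans_le (h3 i)
      · exact h1 _ (h2 i 1 2 (by decide))
    · rw [bruhatRep_mk_true]
      fin_cases a <;> fin_cases b
      · exact h1 _ (h2 i 1 2 (by decide))
      · exact h4 i 1
      · exact h3 i
      · exact h1 _ (h2 i 0 1 (by decide))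
  conv_lhs => rw [← FreeGroup.mk_toWord (x := w)]
  rw [FreeGroup.norm]
  generalize w.toWord = l
  induction l generalizing a b with
  | nil =>
    rw [← FreeGroup.one_eq_mk, map_one]
    fin_cases a <;> fin_cases b <;> simp
  | cons t l ih =>
    rw [bruhatRep_mk_cons, List.length_cons]
    refine (MvPolynomial.degreeOf_add_le _ _ _).trans (max_le ?_ ?_)
    · refine (MvPolynomial.degreeOf_mul_le _ _ _).trans ?_
      have := hletter t a 0
      have := ih 0 b
      omega
    · refine (MvPolynomial.degreeOf_mul_le _ _ _).trans ?_
      have := hletter t a 1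
      have := ih 1 b
      omega

open Polynomial in
/-- The parameters whose second coordinate is scaled by a formal variable. -/
noncomputable def scaledParam {ι R : Type*} [CommRing R] (p : ι → Fin 3 → R) (i : ι) (k : Fin 3) :
    R[X] :=
  if k = 1 then X * C (p i k) else C (p i k)

/-- The entries of the image of a reduced word have degree at most the length of the word, and their
leading coefficients form a matrix of rank one. -/
theorem exists_coeff_bruhatRep_scaledParam {ι R : Type*} [CommRing R] [IsDomain R]
    (p : ι → Fin 3 → R) (hy : ∀ i, p i 1 ≠ 0) (hx : ∀ i j, p i 0 = p j 0 → i = j)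
    (hz : ∀ i j, p i 2 = p j 2 → i = j) (hxz : ∀ i j, p i 2 + p j 0 ≠ 0)
    (l : List (ι × Bool)) (s : ι × Bool) (hl : FreeGroup.IsReduced (s :: l)) :
    ∃ η : Fin 2 → R, η 1 ≠ 0 ∧ ∀ a b,
      (bruhatRep (scaledParam p) (FreeGroup.mk (s :: l)) a b).natDegree ≤ l.length + 1 ∧
      (bruhatRep (scaledParam p) (FreeGroup.mk (s :: l)) a b).coeff (l.length + 1) =
        ![1, if s.2 then p s.1 0 else - p s.1 2] a * η b := by
  have hdeg : ∀ (t : ι × Bool) (a b : Fin 2),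
      (bruhatRep (scaledParam p) (FreeGroup.mk [t]) a b).natDegree ≤ 1 := by
    rintro ⟨i, _ | _⟩ a b
    · rw [bruhatRep_mk_false]
      fin_cases a <;> fin_cases b <;> simp [scaledParam] <;> compute_degree
    · rw [bruhatRep_mk_true]
      fin_cases a <;> fin_cases b <;> simp [scaledParam] <;> compute_degree
  have hcoeff : ∀ (t : ι × Bool) (a b : Fin 2),
      (bruhatRep (scaledParam p) (FreeGroup.mk [t]) a b).coeff 1 =
        ![1, if t.2 then p t.1 0 else - p t.1 2] a *
          (p t.1 1 * ![if t.2 then p t.1 2 else p t.1 0, if t.2 then 1 else -1] b) := by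
    rintro ⟨i, _ | _⟩ a b
    · rw [bruhatRep_mk_false]
      fin_cases a <;> fin_cases b <;>
        simp [scaledParam, Polynomial.coeff_one, mul_assoc, Polynomial.coeff_C] <;>
        ring
    · rw [bruhatRep_mk_true]
      fin_cases a <;> fin_cases b <;>
        simp [scaledParam, Polynomial.coeff_one, mul_assoc, Polynomial.coeff_C]
  induction l generalizing s with
  | nil =>
    refine ⟨fun b => p s.1 1 * ![if s.2 then p s.1 2 else p s.1 0, if s.2 then 1 else -1] b, ?_,
      fun a b => ⟨hdeg s a b, hcoeff s a b⟩⟩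
    refine mul_ne_zero (hy _) ?_
    cases s.2 <;> simp
  | cons t l ih =>
    obtain ⟨hst, hl'⟩ := List.isChain_cons_cons.1 hl
    obtain ⟨η, hη, h⟩ := ih t hl'
    refine ⟨fun b => p s.1 1 * ((if s.2 then p s.1 2 else p s.1 0) + (if s.2 then 1 else -1) *
      (if t.2 then p t.1 0 else - p t.1 2)) * η b, ?_, fun a b => ?_⟩
    · refine mul_ne_zero (mul_ne_zero (hy _) ?_) hη
      rcases s with ⟨i, _ | _⟩ <;> rcases t with ⟨j, _ | _⟩ <;> simp at hst ⊢
      · rw [add_comm]; exact hxz _ _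
      · intro h0; exact hst (hx _ _ (by linear_combination h0))
      · intro h0; exact hst (hz _ _ (by linear_combination h0))
      · exact hxz _ _
    · rw [bruhatRep_mk_cons, List.length_cons, add_comm (l.length + 1) 1]
      refine ⟨Polynomial.natDegree_add_le_of_degree_le
        (Polynomial.natDegree_mul_le_of_le (hdeg s a 0) (h 0 b).1)
        (Polynomial.natDegree_mul_le_of_le (hdeg s a 1) (h 1 b).1), ?_⟩
      rw [Polynomial.coeff_add, Polynomial.coeff_mul_add_eq_of_natDegree_le (hdeg s a 0) (h 0 b).1,
        Polynomial.coeff_mul_add_eq_of_natDegree_le (hdeg s a 1) (h 1 b).1, hcoeff, hcoeff,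
        (h 0 b).2, (h 1 b).2]
      rcases s with ⟨i, _ | _⟩ <;> rcases t with ⟨j, _ | _⟩ <;> simp <;> ring

theorem natDegree_bruhatRep_scaledParam {ι R : Type*} [DecidableEq ι] [CommRing R] [IsDomain R]
    (p : ι → Fin 3 → R) (hy : ∀ i, p i 1 ≠ 0) (hx : ∀ i j, p i 0 = p j 0 → i = j)
    (hz : ∀ i j, p i 2 = p j 2 → i = j) (hxz : ∀ i j, p i 2 + p j 0 ≠ 0)
    {w : FreeGroup ι} (hw : w ≠ 1) :
    (bruhatRep (scaledParam p) w 0 1).natDegree = w.norm := by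
  have hred : FreeGroup.IsReduced w.toWord := FreeGroup.isReduced_toWord
  have hne : w.toWord ≠ [] := by rwa [Ne, FreeGroup.toWord_eq_nil_iff]
  conv_lhs => rw [← FreeGroup.mk_toWord (x := w)]
  rw [FreeGroup.norm]
  generalize w.toWord = l at hred hne
  cases l with
  | nil => exact absurd rfl hne
  | cons s l =>
    obtain ⟨η, hη, h⟩ := exists_coeff_bruhatRep_scaledParam p hy hx hz hxz l s hred
    refine le_antisymm (h 0 1).1 (Polynomial.le_natDegree_of_ne_zero ?_)
    rw [List.length_cons, (h 0 1).2]
    simpa using hη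

theorem exists_ne_zero_sum_pow_mul_aeval_eq_zero {σ : Type*} [Fintype σ] {E : σ → MvPolynomial σ ℚ}
    {L D : ℕ} (hE : ∀ s r, (E s).degreeOf r ≤ L) (r : σ)
    (hD : (D + Fintype.card σ * (D * L) + 1) ^ Fintype.card σ < (D + 1) ^ (Fintype.card σ + 1)) :
    ∃ q : Fin (D + 1) → MvPolynomial σ ℚ, q ≠ 0 ∧
      (∀ j, q j ∈ MvPolynomial.restrictDegree σ ℚ D) ∧
      ∑ j : Fin (D + 1), MvPolynomial.X r ^ (j : ℕ) * MvPolynomial.aeval E (q j) = 0 := by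
  classical
  let T : (Fin (D + 1) → MvPolynomial.restrictDegree σ ℚ D) →ₗ[ℚ] MvPolynomial σ ℚ :=
    ∑ j : Fin (D + 1), (LinearMap.mulLeft ℚ (MvPolynomial.X r ^ (j : ℕ))) ∘ₗ
      (MvPolynomial.aeval E).toLinearMap ∘ₗ (Submodule.subtype _) ∘ₗ LinearMap.proj j
  have hTa : ∀ q, T q = ∑ j : Fin (D + 1), MvPolynomial.X r ^ (j : ℕ) *
      MvPolynomial.aeval E (q j : MvPolynomial σ ℚ) := fun q => by simp [T]
  have hT : ∀ q, T q ∈ MvPolynomial.restrictDegree σ ℚ (D + Fintype.card σ * (D * L)) := by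
    intro q
    rw [hTa]
    refine Submodule.sum_mem _ fun j _ => ?_
    rw [MvPolynomial.mem_restrictDegree]
    intro e he s
    refine (MvPolynomial.le_degreeOf_of_mem_support s he).trans ?_
    refine (MvPolynomial.degreeOf_mul_le _ _ _).trans (add_le_add ?_ ?_)
    · refine (MvPolynomial.degreeOf_pow_le _ _ _).trans ?_
      rw [MvPolynomial.degreeOf_X]
      have := j.2
      split_ifs <;> omega
    · exact MvPolynomial.deg_aeval_le (MvPolynomial.degreeOf s)
        (MvPolynomial.degreeOf_add_le s) (MvPolynomial.degreeOf_mul_le s)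
        (fun c => by rw [MvPolynomial.algebraMap_eq, MvPolynomial.degreeOf_C])
        (fun t => hE t s) (q j).2
  obtain ⟨hfin, hrank⟩ := MvPolynomial.finrank_restrictDegree σ ℚ D
  obtain ⟨hfin', hrank'⟩ := MvPolynomial.finrank_restrictDegree σ ℚ (D + Fintype.card σ * (D * L))
  have hker : LinearMap.ker (T.codRestrict _ hT) ≠ ⊥ := by
    apply LinearMap.ker_ne_bot_of_finrank_lt
    rw [Module.finrank_pi_fintype, hrank']
    simp only [hrank, Finset.sum_const, Finset.card_univ, Fintype.card_fin, smul_eq_mul]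
    rwa [← pow_succ']
  obtain ⟨q, hq, hq0⟩ := Submodule.exists_mem_ne_zero_of_ne_bot hker
  refine ⟨fun j => q j, fun h => hq0 ?_, fun j => (q j).2, ?_⟩
  · ext1 j
    exact Subtype.ext (congrFun h j)
  · rw [← hTa]
    exact congrArg Subtype.val hq

/-- The substitution `x ↦ x y`, `z ↦ y z` is injective on polynomials. -/
theorem eq_zero_of_aeval_mul_eq_zero {ι : Type*} {q : MvPolynomial (ι × Fin 3) ℚ}
    (hq : MvPolynomial.aeval (fun s : ι × Fin 3 => (if s.2 = 1 then MvPolynomial.X s else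
      MvPolynomial.X s * MvPolynomial.X (s.1, 1) : MvPolynomial (ι × Fin 3) ℚ)) q = 0) : q = 0 := by
  let F := FractionRing (MvPolynomial (ι × Fin 3) ℚ)
  let a := algebraMap (MvPolynomial (ι × Fin 3) ℚ) F
  have ha : Function.Injective a := IsFractionRing.injective _ _
  let ψ : MvPolynomial (ι × Fin 3) ℚ →ₐ[ℚ] F := MvPolynomial.aeval fun s =>
    if s.2 = 1 then a (MvPolynomial.X s) else a (MvPolynomial.X s) / a (MvPolynomial.X (s.1, 1))
  have h := congrArg ψ hq
  rw [map_zero, MvPolynomial.comp_aeval_apply] at h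
  have h2 : (fun s : ι × Fin 3 => ψ (if s.2 = 1 then MvPolynomial.X s else
      MvPolynomial.X s * MvPolynomial.X (s.1, 1))) = fun s => a (MvPolynomial.X s) := by
    funext s
    have : a (MvPolynomial.X (s.1, 1)) ≠ 0 :=
      (map_ne_zero_iff a ha).2 (MvPolynomial.X_ne_zero _)
    split_ifs with hs
    · simp [ψ, hs]
    · simp only [ψ, hs, if_false, map_mul, MvPolynomial.aeval_X, if_true]
      exact div_mul_cancel₀ _ this
  rw [h2] at h
  have h3 : MvPolynomial.aeval (fun s => a (MvPolynomial.X s)) q = a q := by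
    have := MvPolynomial.comp_aeval_apply (f := MvPolynomial.X)
      (Algebra.algHom ℚ (MvPolynomial (ι × Fin 3) ℚ) F) q
    rw [MvPolynomial.aeval_X_left_apply] at this
    exact this.symm
  rw [h3] at h
  exact (map_eq_zero_iff a ha).1 h

/-- The coordinates of a tuple of matrices in `SL(2, R)`: the upper right entries, and the diagonal
entries minus one. -/
noncomputable def bruhatCoord {ι R : Type*} [CommRing R] (g : ι → SL(2, R)) (s : ι × Fin 3) : R :=
  ![g s.1 1 1 - 1, g s.1 0 1, g s.1 0 0 - 1] s.2

theorem map_bruhatCoord {ι R S : Type*} [CommRing R] [CommRing S] (θ : R →+* S)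
    (g : ι → SL(2, R)) (s : ι × Fin 3) :
    θ (bruhatCoord g s) = bruhatCoord (fun i => Matrix.SpecialLinearGroup.map θ (g i)) s := by
  rcases s with ⟨i, k⟩
  fin_cases k <;> simp [bruhatCoord]

/-- An algebraic relation among the coordinates of the generators of a free group and those of
their images under an automorphism specialises to the coordinates given by any representation. -/
theorem sum_pow_mul_aeval_eq_zero_of_mulAut {ι S : Type*} [CommRing S] [IsDomain S] [Algebra ℚ S]
    (f : MulAut (FreeGroup ι)) (ρ : FreeGroup ι →* SL(2, S))
    (hρ : ∀ i, ρ (f⁻¹ (FreeGroup.of i)) 0 1 ≠ 0) (i₀ : ι) {k : ℕ}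
    (q : Fin k → MvPolynomial (ι × Fin 3) ℚ)
    (h : ∑ j : Fin k, MvPolynomial.X (i₀, 1) ^ (j : ℕ) * MvPolynomial.aeval
      (bruhatCoord fun i => bruhatRep (fun i k => (MvPolynomial.X (i, k) :
        MvPolynomial (ι × Fin 3) ℚ)) (f (FreeGroup.of i))) (q j) = 0) :
    ∑ j : Fin k, ρ (f⁻¹ (FreeGroup.of i₀)) 0 1 ^ (j : ℕ) * MvPolynomial.aeval
      (bruhatCoord fun i => ρ (FreeGroup.of i)) (q j) = 0 := by
  let F := FractionRing S
  let a := algebraMap S F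
  have ha : Function.Injective a := IsFractionRing.injective _ _
  let g : ι → SL(2, F) := fun i => Matrix.SpecialLinearGroup.map a (ρ (f⁻¹ (FreeGroup.of i)))
  have hg : ∀ i, g i 0 1 = a (ρ (f⁻¹ (FreeGroup.of i)) 0 1) := fun i => by simp [g]
  let p : ι → Fin 3 → F := fun i =>
    ![(g i 1 1 - 1) / g i 0 1, g i 0 1, (g i 0 0 - 1) / g i 0 1]
  have hp : bruhatRep p = ((Matrix.SpecialLinearGroup.map a).comp ρ).comp
      (f⁻¹ : MulAut (FreeGroup ι)).toMonoidHom := by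
    refine FreeGroup.ext_hom _ _ fun i => ?_
    rw [bruhatRep_of]
    exact bruhatMatrix_of_ne_zero (g i) (by rw [hg]; exact (map_ne_zero_iff a ha).2 (hρ i))
  let θ : MvPolynomial (ι × Fin 3) ℚ →ₐ[ℚ] F := MvPolynomial.aeval fun s => p s.1 s.2
  have hθX : ∀ i k, θ (MvPolynomial.X (i, k)) = p i k := fun i k => MvPolynomial.aeval_X _ _
  have hθ : ∀ s, θ (bruhatCoord (fun i => bruhatRep (fun i k => (MvPolynomial.X (i, k) :
        MvPolynomial (ι × Fin 3) ℚ)) (f (FreeGroup.of i))) s) =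
      Algebra.algHom ℚ S F (bruhatCoord (fun i => ρ (FreeGroup.of i)) s) := by
    intro s
    refine (map_bruhatCoord θ.toRingHom _ s).trans (Eq.trans ?_ (map_bruhatCoord a _ s).symm)
    congr 1
    funext i
    rw [map_bruhatRep]
    have : (fun i k => θ.toRingHom (MvPolynomial.X (i, k))) = p := by
      funext i k
      exact hθX i k
    rw [this, hp]
    simp
  have h' := congrArg θ h
  rw [map_zero, map_sum] at h'
  apply ha
  rw [map_zero, map_sum, ← h']
  refine Finset.sum_congr rfl fun j _ => ?_
  rw [map_mul, map_mul, map_pow, map_pow, MvPolynomial.comp_aeval_apply]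
  congr 1
  · congr 1
    rw [hθX]
    exact (hg i₀).symm
  · refine (MvPolynomial.comp_aeval_apply _ (Algebra.algHom ℚ S F) (q j)).trans ?_
    simp only [hθ]

theorem norm_inv_apply_of_le {ι : Type*} [Fintype ι] [DecidableEq ι] (f : MulAut (FreeGroup ι))
    {L : ℕ} (hL : 1 ≤ L) (hf : ∀ i, (f (FreeGroup.of i)).norm ≤ L) (i₀ : ι) :
    (f⁻¹ (FreeGroup.of i₀)).norm ≤
      Fintype.card (ι × Fin 3) *
        ((Fintype.card (ι × Fin 3) + 1) * L) ^ Fintype.card (ι × Fin 3) := by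
  set n := Fintype.card (ι × Fin 3)
  set D := ((n + 1) * L) ^ n
  have hcount : (D + n * (D * L) + 1) ^ n < (D + 1) ^ (n + 1) := by
    calc (D + n * (D * L) + 1) ^ n ≤ ((D + 1) * ((n + 1) * L)) ^ n := by
          gcongr
          nlinarith [Nat.zero_le (n * L), Nat.mul_le_mul_left D hL]
      _ = (D + 1) ^ n * D := by rw [mul_pow]
      _ < (D + 1) ^ n * (D + 1) := by gcongr; omega
      _ = (D + 1) ^ (n + 1) := (pow_succ _ _).symm
  obtain ⟨q, hq0, hqD, hq⟩ := exists_ne_zero_sum_pow_mul_aeval_eq_zero (E := bruhatCoord fun i =>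
    bruhatRep (fun i k => (MvPolynomial.X (i, k) : MvPolynomial (ι × Fin 3) ℚ))
      (f (FreeGroup.of i))) (L := L) (D := D) (fun s r => by
        have h := fun a b => (degreeOf_bruhatRep_le r (f (FreeGroup.of s.1)) a b).trans (hf s.1)
        have h1 : ∀ q : MvPolynomial (ι × Fin 3) ℚ, q.degreeOf r ≤ L → (q - 1).degreeOf r ≤ L :=
          fun q hq => (MvPolynomial.degreeOf_sub_le _ _ _).trans (by simp [hq])
        rcases s with ⟨i, k⟩
        fin_cases k
        · exact h1 _ (h 1 1)
        · exact h 0 1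
        · exact h1 _ (h 0 0)) (i₀, 1) hcount
  by_contra! hlt
  let p : ι → Fin 3 → MvPolynomial (ι × Fin 3) ℚ := fun i k => MvPolynomial.X (i, k)
  have hX : ∀ s t : ι × Fin 3, (MvPolynomial.X s : MvPolynomial (ι × Fin 3) ℚ) = MvPolynomial.X t →
    s = t := fun s t h => MvPolynomial.X_injective h
  have hXne : ∀ s t : ι × Fin 3, s ≠ t → (MvPolynomial.X s : MvPolynomial (ι × Fin 3) ℚ) +
      MvPolynomial.X t ≠ 0 := by
    intro s t hst h
    have := congrArg (MvPolynomial.eval fun r => if r = s then (1 : ℚ) else 0) h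
    simp [hst.symm] at this
  have hu : ∀ i, (bruhatRep (scaledParam p) (f⁻¹ (FreeGroup.of i)) 0 1).natDegree =
      (f⁻¹ (FreeGroup.of i)).norm := fun i =>
    natDegree_bruhatRep_scaledParam p (fun i => MvPolynomial.X_ne_zero _)
      (fun i j h => congrArg Prod.fst (hX _ _ h)) (fun i j h => congrArg Prod.fst (hX _ _ h))
      (fun i j => hXne _ _ (by simp)) (by simp)
  have hune : ∀ i, bruhatRep (scaledParam p) (f⁻¹ (FreeGroup.of i)) 0 1 ≠ 0 := by
    intro i h
    have := hu i
    rw [h, Polynomial.natDegree_zero, eq_comm, FreeGroup.norm_eq_zero] at this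
    simp at this
  have hrel := sum_pow_mul_aeval_eq_zero_of_mulAut f (bruhatRep (scaledParam p)) hune i₀ q hq
  have hE : ∀ s, bruhatCoord (fun i => bruhatRep (scaledParam p) (FreeGroup.of i)) s =
      Polynomial.X * Polynomial.C (if s.2 = 1 then MvPolynomial.X s else
      MvPolynomial.X s * MvPolynomial.X (s.1, 1) : MvPolynomial (ι × Fin 3) ℚ) := by
    rintro ⟨i, k⟩
    fin_cases k <;> simp [bruhatCoord, bruhatRep_of, coe_bruhatMatrix, scaledParam, p] <;> ring
  have hEdeg : ∀ s, (bruhatCoord (fun i => bruhatRep (scaledParam p) (FreeGroup.of i)) s).natDegree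
      ≤ 1 := fun s => by
    rw [hE]
    exact Polynomial.natDegree_mul_le_of_le Polynomial.natDegree_X_le (Polynomial.natDegree_C _).le
  have hC : ∀ c : ℚ, (algebraMap ℚ (Polynomial (MvPolynomial (ι × Fin 3) ℚ)) c).natDegree = 0 :=
    fun c => by
      rw [IsScalarTower.algebraMap_apply ℚ (MvPolynomial (ι × Fin 3) ℚ), Polynomial.algebraMap_eq,
        Polynomial.natDegree_C]
  have hdeg : ∀ j, (MvPolynomial.aeval (bruhatCoord fun i => bruhatRep (scaledParam p)
      (FreeGroup.of i)) (q j)).natDegree ≤ n * (D * 1) := fun j =>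
    MvPolynomial.deg_aeval_le (R := Polynomial (MvPolynomial (ι × Fin 3) ℚ)) Polynomial.natDegree
      (fun _ _ => Polynomial.natDegree_add_le _ _) (fun _ _ => Polynomial.natDegree_mul_le)
      hC hEdeg (hqD j)
  have hzero := Polynomial.eq_zero_of_sum_pow_mul_eq_zero _ _ (fun j => by
    rw [hu]
    exact (hdeg j).trans_lt (by rwa [mul_one])) hrel
  refine hq0 (funext fun j => eq_zero_of_aeval_mul_eq_zero ?_)
  have h := congrArg (Polynomial.aeval (1 : MvPolynomial (ι × Fin 3) ℚ)) (hzero j)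
  rw [map_zero] at h
  have h2 := MvPolynomial.comp_aeval_apply (f := bruhatCoord (fun i => bruhatRep (scaledParam p)
    (FreeGroup.of i))) ((Polynomial.aeval (R := MvPolynomial (ι × Fin 3) ℚ)
      (1 : MvPolynomial (ι × Fin 3) ℚ)).restrictScalars ℚ) (q j)
  simp only [AlgHom.restrictScalars_apply, h, hE, map_mul, Polynomial.aeval_X, Polynomial.aeval_C,
    one_mul, Algebra.algebraMap_self, RingHom.id_apply] at h2
  exact h2.symm

end BruhatRep

section FreeFactor

theorem isFreeFactor_closure_image_of {ι : Type*} (s : Set ι) :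
    IsFreeFactor (Subgroup.closure (FreeGroup.of '' s)) := by
  classical
  refine ⟨Subgroup.closure (FreeGroup.of '' sᶜ), ?_⟩
  set A := Subgroup.closure (FreeGroup.of '' s)
  set B := Subgroup.closure (FreeGroup.of '' sᶜ)
  have hA : ∀ i ∈ s, FreeGroup.of i ∈ A := fun i hi =>
    Subgroup.subset_closure (Set.mem_image_of_mem _ hi)
  have hB : ∀ i, i ∉ s → FreeGroup.of i ∈ B := fun i hi =>
    Subgroup.subset_closure (Set.mem_image_of_mem _ hi)
  let ψ : FreeGroup ι →* Monoid.Coprod A B := FreeGroup.lift fun i =>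
    if h : i ∈ s then Monoid.Coprod.inl ⟨FreeGroup.of i, hA i h⟩
    else Monoid.Coprod.inr ⟨FreeGroup.of i, hB i h⟩
  have h1 : (Monoid.Coprod.lift A.subtype B.subtype).comp ψ = MonoidHom.id _ := by
    refine FreeGroup.ext_hom _ _ fun i => ?_
    by_cases h : i ∈ s <;> simp [ψ, h]
  have h2 : ψ.comp (Monoid.Coprod.lift A.subtype B.subtype) = MonoidHom.id _ := by
    refine Monoid.Coprod.hom_ext ?_ ?_
    · ext ⟨x, hx⟩
      simp only [MonoidHom.comp_apply, Monoid.Coprod.lift_apply_inl, MonoidHom.id_apply,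
        Subgroup.subtype_apply]
      induction hx using Subgroup.closure_induction with
      | mem x hx =>
        obtain ⟨i, hi, rfl⟩ := hx
        simp [ψ, hi]
      | one => rw [map_one]; exact (map_one _).symm
      | mul x y hx hy ihx ihy => rw [map_mul, ihx, ihy, ← map_mul]; rfl
      | inv x hx ih => rw [map_inv, ih, ← map_inv]; rfl
    · ext ⟨x, hx⟩
      simp only [MonoidHom.comp_apply, Monoid.Coprod.lift_apply_inr, MonoidHom.id_apply,
        Subgroup.subtype_apply]
      induction hx using Subgroup.closure_induction with
      | mem x hx =>
        obtain ⟨i, hi, rfl⟩ := hx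
        simp [ψ, show i ∉ s from hi]
      | one => rw [map_one]; exact (map_one _).symm
      | mul x y hx hy ihx ihy => rw [map_mul, ihx, ihy, ← map_mul]; rfl
      | inv x hx ih => rw [map_inv, ih, ← map_inv]; rfl
  exact ⟨Function.LeftInverse.injective (DFunLike.congr_fun h2),
    Function.RightInverse.surjective (DFunLike.congr_fun h1)⟩

theorem closure_image_of_ne_top {ι : Type*} {s : Set ι} {i : ι} (hi : i ∉ s) :
    Subgroup.closure (FreeGroup.of '' s) ≠ (⊤ : Subgroup (FreeGroup ι)) := by
  classical
  let ψ : FreeGroup ι →* FreeGroup ι := FreeGroup.lift fun i => if i ∈ s then 1 else FreeGroup.of i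
  intro h
  have hle : Subgroup.closure (FreeGroup.of '' s) ≤ ψ.ker := by
    rw [Subgroup.closure_le]
    rintro _ ⟨j, hj, rfl⟩
    simp [ψ, hj, MonoidHom.mem_ker]
  have := hle (h ▸ Subgroup.mem_top (FreeGroup.of i))
  simp [ψ, hi, MonoidHom.mem_ker] at this

theorem not_isPeriodicClass_of {N : ℕ} (hN : 2 ≤ N) {φ : Out (FreeGroupN N)}
    (hφ : FullyIrreducible φ) {f : MulAut (FreeGroupN N)}
    (hf : (QuotientGroup.mk f : Out (FreeGroupN N)) = φ) (i : Fin N) :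
    ¬ IsPeriodicClass f (ConjClasses.mk (FreeGroup.of i)) := by
  rintro ⟨k, hk, h⟩
  obtain ⟨c, hc⟩ := isConj_iff.1 (ConjClasses.mk_eq_mk_iff_isConj.1 h.symm)
  have : Nontrivial (Fin N) := Fin.nontrivial_iff_two_le.2 hN
  obtain ⟨j, hj⟩ := exists_ne i
  refine hφ k hk (f ^ k) (by rw [← hf]; rfl) _ (isFreeFactor_closure_image_of {i}) ?_
    (closure_image_of_ne_top (i := j) (by simpa using hj)) c ?_
  · simp [Subgroup.closure_eq_bot_iff]
  · rw [MonoidHom.map_closure, MonoidHom.map_closure]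
    simp only [Set.image_singleton]
    congr 2
    exact hc.symm

theorem IsPeriodicClass.of_inv {N : ℕ} {f : MulAut (FreeGroupN N)} {w : FreeGroupN N}
    (h : IsPeriodicClass f⁻¹ (ConjClasses.mk w)) : IsPeriodicClass f (ConjClasses.mk w) := by
  obtain ⟨k, hk, h⟩ := h
  refine ⟨k, hk, ?_⟩
  obtain ⟨c, hc⟩ := isConj_iff.1 (ConjClasses.mk_eq_mk_iff_isConj.1 h.symm)
  refine (ConjClasses.mk_eq_mk_iff_isConj.2 (isConj_iff.2 ⟨(f ^ k) c, ?_⟩))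
  have := congrArg (f ^ k) hc
  simp only [map_mul, map_inv] at this
  rw [MonoidHom.coe_coe]
  refine this.trans ?_
  rw [MonoidHom.coe_coe, ← MulAut.mul_apply, inv_pow, mul_inv_cancel, MulAut.one_apply]

end FreeFactor

section CycLength

variable {N : ℕ}

theorem cycLength_refl_le_of_isConj {w v : FreeGroupN N} (h : IsConj v w) :
    cycLength (MulEquiv.refl _) (ConjClasses.mk w) ≤ v.norm :=
  Nat.sInf_le ⟨v, ConjClasses.mk_eq_mk_iff_isConj.2 h, rfl⟩

theorem exists_norm_conj_eq_cycLength (w : FreeGroupN N) :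
    ∃ c, (c * w * c⁻¹).norm = cycLength (MulEquiv.refl _) (ConjClasses.mk w) := by
  obtain ⟨v, hv, h⟩ := Nat.sInf_mem (s := (fun g => ((MulEquiv.refl (FreeGroupN N)) g).norm) ''
    {g : FreeGroupN N | ConjClasses.mk g = ConjClasses.mk w}) ⟨_, w, rfl, rfl⟩
  obtain ⟨c, hc⟩ := isConj_iff.1 (ConjClasses.mk_eq_mk_iff_isConj.1 hv.symm)
  exact ⟨c, by rw [hc]; exact h⟩

theorem one_le_cycLength {w : FreeGroupN N} (hw : w ≠ 1) :
    1 ≤ cycLength (MulEquiv.refl _) (ConjClasses.mk w) := by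
  obtain ⟨c, hc⟩ := exists_norm_conj_eq_cycLength w
  rw [← hc, Nat.one_le_iff_ne_zero, Ne, FreeGroup.norm_eq_zero]
  intro h
  exact hw (conj_eq_one_iff.1 h)

theorem exists_forall_le_mul_pow_of_eventually {a : ℕ → ℕ} {μ : ℝ} (hμ : 1 ≤ μ)
    (h : ∀ᶠ n in Filter.atTop, (a n : ℝ) ≤ μ ^ n) : ∃ B : ℕ, ∀ n, (a n : ℝ) ≤ B * μ ^ n := by
  obtain ⟨n₀, hn₀⟩ := Filter.eventually_atTop.1 h
  refine ⟨1 + ∑ k ∈ Finset.range n₀, a k, fun n => ?_⟩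
  have h1 : (1 : ℝ) ≤ μ ^ n := one_le_pow₀ hμ
  rcases le_or_gt n₀ n with hn | hn
  · refine (hn₀ n hn).trans (le_mul_of_one_le_left (by positivity) ?_)
    push_cast
    have : (0 : ℝ) ≤ ∑ k ∈ Finset.range n₀, (a k : ℝ) := by positivity
    linarith
  · have := Finset.single_le_sum (f := a) (fun _ _ => Nat.zero_le _) (Finset.mem_range.2 hn)
    refine le_trans ?_ (le_mul_of_one_le_right (by positivity) h1)
    exact_mod_cast this.trans (by omega)

theorem exists_cycLength_le_mul_pow {φ : Out (FreeGroupN N)} {l : ℝ} (hl : HasStretchFactor φ l)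
    {f : MulAut (FreeGroupN N)} (hf : (QuotientGroup.mk f : Out (FreeGroupN N)) = φ) {μ : ℝ}
    (hμ : 1 ≤ μ) (hlμ : l < μ) (w : FreeGroupN N) :
    ∃ B : ℕ, ∀ n, (cycLength (MulEquiv.refl _) (ConjClasses.mk ((f ^ n) w)) : ℝ) ≤ B * μ ^ n := by
  by_cases hw : IsPeriodicClass f (ConjClasses.mk w)
  · obtain ⟨k, hk, h⟩ := hw
    have hper : ∀ n, cycLength (MulEquiv.refl _) (ConjClasses.mk ((f ^ n) w)) =
        cycLength (MulEquiv.refl _) (ConjClasses.mk ((f ^ (n % k)) w)) := by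
      intro n
      have hm : ∀ m, ConjClasses.mk (((f ^ k) ^ m) w) = ConjClasses.mk w := by
        intro m
        induction m with
        | zero => rfl
        | succ m ih =>
          rw [pow_succ', MulAut.mul_apply]
          exact (congrArg (ConjClasses.map ((f ^ k : MulAut (FreeGroupN N)) :
            FreeGroupN N →* FreeGroupN N)) ih).trans h
      congr 1
      conv_lhs => rw [← Nat.mod_add_div n k, pow_add, pow_mul, MulAut.mul_apply]
      exact congrArg (ConjClasses.map ((f ^ (n % k) : MulAut (FreeGroupN N)) :
            FreeGroupN N →* FreeGroupN N)) (hm (n / k))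
    refine ⟨∑ j ∈ Finset.range k, cycLength (MulEquiv.refl _) (ConjClasses.mk ((f ^ j) w)),
      fun n => ?_⟩
    refine le_trans ?_ (le_mul_of_one_le_right (by positivity) (one_le_pow₀ hμ))
    rw [hper]
    exact_mod_cast Finset.single_le_sum
      (f := fun j => cycLength (MulEquiv.refl _) (ConjClasses.mk ((f ^ j) w)))
      (fun _ _ => Nat.zero_le _) (Finset.mem_range.2 (Nat.mod_lt n hk))
  · refine exists_forall_le_mul_pow_of_eventually
      (a := fun n => cycLength (MulEquiv.refl _) (ConjClasses.mk ((f ^ n) w))) hμ ?_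
    have ht := hl f hf (MulEquiv.refl _) _ hw
    filter_upwards [ht.eventually (gt_mem_nhds hlμ), Filter.eventually_ge_atTop 1] with n hn hn1
    have hn0 : (n : ℝ) ≠ 0 := by positivity
    have := Real.rpow_le_rpow (by positivity) hn.le (Nat.cast_nonneg n)
    rwa [← Real.rpow_mul (by positivity), one_div_mul_cancel hn0, Real.rpow_one,
      Real.rpow_natCast] at this

theorem one_le_of_hasStretchFactor {φ : Out (FreeGroupN N)} {l : ℝ} (hl : HasStretchFactor φ l)
    {f : MulAut (FreeGroupN N)} (hf : (QuotientGroup.mk f : Out (FreeGroupN N)) = φ)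
    {w : FreeGroupN N} (hw : w ≠ 1) (hper : ¬ IsPeriodicClass f (ConjClasses.mk w)) : 1 ≤ l := by
  refine ge_of_tendsto' (hl f hf (MulEquiv.refl _) _ hper) fun n => ?_
  refine Real.one_le_rpow ?_ (by positivity)
  exact_mod_cast one_le_cycLength (w := (f ^ n) w) (by simpa using hw)

/-- The conjugacy classes of the images of basis elements under the inverse of an automorphism have
length bounded by a polynomial in the lengths of the images of short conjugacy classes. -/
theorem cycLength_inv_apply_of_le {f : MulAut (FreeGroupN N)} {K : ℕ}
    (h₁ : ∀ i, cycLength (MulEquiv.refl _) (ConjClasses.mk (f (FreeGroup.of i))) ≤ K)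
    (h₂ : ∀ i j, cycLength (MulEquiv.refl _)
      (ConjClasses.mk (f (FreeGroup.of i * FreeGroup.of j))) ≤ K) (i₀ : Fin N) :
    cycLength (MulEquiv.refl _) (ConjClasses.mk (f⁻¹ (FreeGroup.of i₀))) ≤
      (N * 3) * ((N * 3 + 1) * (K + 2)) ^ (N * 3) := by
  obtain ⟨c, hc⟩ := FreeGroup.exists_forall_norm_conj_le K
    (∑ i, (f (FreeGroup.of i)).norm) (fun i => f (FreeGroup.of i))
    (fun i => (exists_norm_conj_eq_cycLength _).imp fun c hc => hc.trans_le (h₁ i))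
    (fun i j => (exists_norm_conj_eq_cycLength _).imp fun c hc => by
      rw [← map_mul]; exact hc.trans_le (h₂ i j))
    (fun i => Finset.single_le_sum (f := fun i => (f (FreeGroup.of i)).norm)
      (fun _ _ => Nat.zero_le _) (Finset.mem_univ i))
  have h := norm_inv_apply_of_le (MulAut.conj c * f) (L := K + 2) (by omega) hc i₀
  rw [Fintype.card_prod, Fintype.card_fin, Fintype.card_fin] at h
  refine (cycLength_refl_le_of_isConj (isConj_iff.2 ⟨f⁻¹ c, ?_⟩)).trans h
  rw [mul_inv_rev, MulAut.mul_apply, ← map_inv MulAut.conj, MulAut.conj_apply]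
  simp [mul_assoc]

theorem le_of_tendsto_rpow_of_le_mul_pow {a : ℕ → ℕ} {l A ν : ℝ} (hA : 0 < A) (hν : 0 ≤ ν)
    (ha : ∀ n, (a n : ℝ) ≤ A * ν ^ n)
    (h : Filter.Tendsto (fun n : ℕ => (a n : ℝ) ^ (1 / (n : ℝ))) Filter.atTop (nhds l)) :
    l ≤ ν := by
  have hlim : Filter.Tendsto (fun n : ℕ => A ^ (1 / (n : ℝ)) * ν) Filter.atTop (nhds ν) := by
    have h0 : Filter.Tendsto (fun n : ℕ => A ^ (1 / (n : ℝ))) Filter.atTop (nhds (A ^ (0 : ℝ))) :=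
      tendsto_const_nhds.rpow tendsto_one_div_atTop_nhds_zero_nat (Or.inl hA.ne')
    simpa using h0.mul_const ν
  refine le_of_tendsto_of_tendsto h hlim ?_
  filter_upwards [Filter.eventually_ge_atTop 1] with n hn
  have hn0 : (n : ℝ) ≠ 0 := by positivity
  refine (Real.rpow_le_rpow (by positivity) (ha n) (by positivity)).trans_eq ?_
  rw [Real.mul_rpow hA.le (by positivity), ← Real.rpow_natCast, ← Real.rpow_mul hν,
    mul_one_div_cancel hn0, Real.rpow_one]

end CycLength

/-- (Handel–Mosher) For every `N ≥ 2` there is a finite constant `C_N` such that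
`log λ(φ) ≤ C_N · log λ(φ⁻¹)` for every fully irreducible `φ ∈ Out(F_N)`. -/
theorem handel_mosher_bounded_asymmetry :
    ∀ N : ℕ, 2 ≤ N →
      ∃ C : ℝ, ∀ φ : Out (FreeGroupN N), FullyIrreducible φ →
        ∀ l li : ℝ, HasStretchFactor φ l → HasStretchFactor φ⁻¹ li →
          Real.log l ≤ C * Real.log li := by
  intro N hN
  refine ⟨(N * 3 : ℕ), fun φ hφ l li hl hli => ?_⟩
  obtain ⟨f, hf⟩ : ∃ f : MulAut (FreeGroupN N), (QuotientGroup.mk f : Out (FreeGroupN N)) = φ :=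
    QuotientGroup.mk_surjective φ
  have hfi : (QuotientGroup.mk f⁻¹ : Out (FreeGroupN N)) = φ⁻¹ := by rw [← hf]; rfl
  obtain ⟨i₀⟩ : Nonempty (Fin N) := ⟨⟨0, by omega⟩⟩
  have hper := not_isPeriodicClass_of hN hφ hf i₀
  have hl1 : 1 ≤ l := one_le_of_hasStretchFactor hl hf (FreeGroup.of_ne_one i₀) hper
  have hli1 : 1 ≤ li := one_le_of_hasStretchFactor hli hfi (FreeGroup.of_ne_one i₀)
    fun h => hper h.of_inv
  have key : ∀ μ, li < μ → l ≤ μ ^ (N * 3) := by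
    intro μ hμ
    have hμ1 : 1 ≤ μ := hli1.trans hμ.le
    choose B₁ hB₁ using fun i : Fin N =>
      exists_cycLength_le_mul_pow hli hfi hμ1 hμ (FreeGroup.of i)
    choose B₂ hB₂ using fun i j : Fin N =>
      exists_cycLength_le_mul_pow hli hfi hμ1 hμ (FreeGroup.of i * FreeGroup.of j)
    let B : ℕ := ∑ i, B₁ i + ∑ i, ∑ j, B₂ i j
    have hB₁B : ∀ i, B₁ i ≤ B := fun i =>
      (Finset.single_le_sum (f := B₁) (fun _ _ => Nat.zero_le _) (Finset.mem_univ i)).trans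
        (Nat.le_add_right _ _)
    have hB₂B : ∀ i j, B₂ i j ≤ B := fun i j =>
      ((Finset.single_le_sum (f := B₂ i) (fun _ _ => Nat.zero_le _) (Finset.mem_univ j)).trans
        (Finset.single_le_sum (f := fun i => ∑ j, B₂ i j) (fun _ _ => Nat.zero_le _)
          (Finset.mem_univ i))).trans (Nat.le_add_left _ _)
    have hbound : ∀ n, (cycLength (MulEquiv.refl _)
        (ConjClasses.mk ((f ^ n) (FreeGroup.of i₀))) : ℝ) ≤
        ((N * 3 : ℕ) * (((N * 3 : ℕ) + 1) * (B + 2)) ^ (N * 3)) * (μ ^ (N * 3)) ^ n := by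
      intro n
      have hμn : 1 ≤ μ ^ n := one_le_pow₀ hμ1
      have h := cycLength_inv_apply_of_le (f := f⁻¹ ^ n) (K := ⌊B * μ ^ n⌋₊)
        (fun i => Nat.le_floor ((hB₁ i n).trans (by gcongr; exact hB₁B i)))
        (fun i j => Nat.le_floor ((hB₂ i j n).trans (by gcongr; exact hB₂B i j))) i₀
      rw [inv_pow, inv_inv] at h
      have hfl : (⌊B * μ ^ n⌋₊ : ℝ) + 2 ≤ (B + 2) * μ ^ n := by
        have := Nat.floor_le (a := B * μ ^ n) (by positivity)
        linarith
      calc _ ≤ (((N * 3) * ((N * 3 + 1) * (⌊B * μ ^ n⌋₊ + 2)) ^ (N * 3) : ℕ) : ℝ) := by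
            exact_mod_cast h
        _ = (N * 3 : ℕ) * (((N * 3 : ℕ) + 1) * ((⌊B * μ ^ n⌋₊ : ℝ) + 2)) ^ (N * 3) := by
            push_cast; rfl
        _ ≤ (N * 3 : ℕ) * (((N * 3 : ℕ) + 1) * ((B + 2) * μ ^ n)) ^ (N * 3) := by gcongr
        _ = _ := by rw [← mul_assoc ((N * 3 : ℕ) + 1 : ℝ), mul_pow _ (μ ^ n), pow_right_comm μ,
                      mul_assoc]
    have ht := hl f hf (MulEquiv.refl _) _ hper
    have hA : (0 : ℝ) < (N * 3 : ℕ) * (((N * 3 : ℕ) + 1) * (B + 2)) ^ (N * 3) := by positivity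
    exact le_of_tendsto_rpow_of_le_mul_pow
      (a := fun n => cycLength (MulEquiv.refl _) (ConjClasses.mk ((f ^ n) (FreeGroup.of i₀))))
      hA (by positivity) hbound ht
  have hle : l ≤ li ^ (N * 3) := by
    refine ge_of_tendsto (f := fun μ : ℝ => μ ^ (N * 3)) (x := nhdsWithin li (Set.Ioi li))
      ((continuous_pow (N * 3)).continuousAt.tendsto.mono_left nhdsWithin_le_nhds) ?_
    filter_upwards [self_mem_nhdsWithin] with μ hμ using key μ hμ
  rw [← Real.log_pow]
  exact Real.log_le_log (by linarith) hle
end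

section
/- Let F_3 = ⟨a, b, c⟩ be the free group of rank 3 and let φ ∈ Aut(F_3) be the automorphism determined by φ(a) = b, φ(b) = b⁻¹a⁻¹bac, and φ(c) = a. Then the image of φ in Out(F_3) is fully irreducible. -/
/-- The group of elements `1 + v + m` of the ring of noncommutative power series over `ℤ` in three
variables, truncated above degree two: `v` is the linear part and `m` the quadratic part. -/
@[ext]
structure TruncatedSeries where
  v : Fin 3 → ℤ
  m : Fin 3 → Fin 3 → ℤ

namespace TruncatedSeries

instance : Mul TruncatedSeries :=
  ⟨fun x y => ⟨x.v + y.v, fun i j => x.m i j + x.v i * y.v j + y.m i j⟩⟩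

instance : One TruncatedSeries := ⟨⟨0, 0⟩⟩

instance : Inv TruncatedSeries := ⟨fun x => ⟨-x.v, fun i j => -x.m i j + x.v i * x.v j⟩⟩

@[simp] lemma mul_v (x y : TruncatedSeries) (i : Fin 3) : (x * y).v i = x.v i + y.v i := rfl

@[simp] lemma mul_m (x y : TruncatedSeries) (i j : Fin 3) :
    (x * y).m i j = x.m i j + x.v i * y.v j + y.m i j := rfl

@[simp] lemma one_v (i : Fin 3) : (1 : TruncatedSeries).v i = 0 := rfl

@[simp] lemma one_m (i j : Fin 3) : (1 : TruncatedSeries).m i j = 0 := rfl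

@[simp] lemma inv_v (x : TruncatedSeries) (i : Fin 3) : x⁻¹.v i = -x.v i := rfl

@[simp] lemma inv_m (x : TruncatedSeries) (i j : Fin 3) :
    x⁻¹.m i j = -x.m i j + x.v i * x.v j := rfl

instance : Group TruncatedSeries :=
  Group.ofLeftAxioms
    (fun x y z => by
      ext i
      · simp [add_assoc]
      · simp; ring)
    (fun x => by ext <;> simp)
    (fun x => by ext <;> simp)

/-- The full antisymmetrisation of `u ⊗ m` for a vector `u` and a matrix `m`. -/
def alternation (u : Fin 3 → ℤ) (m : Fin 3 → Fin 3 → ℤ) : ℤ :=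
  u 0 * (m 1 2 - m 2 1) + u 1 * (m 2 0 - m 0 2) + u 2 * (m 0 1 - m 1 0)

/-- The alternation of the linear part of `x` with its quadratic part. -/
def disc (x : TruncatedSeries) : ℤ := alternation x.v x.m

lemma conj_v (x y : TruncatedSeries) : (y * x * y⁻¹).v = x.v := by
  ext i; simp

lemma disc_conj (x y : TruncatedSeries) : disc (y * x * y⁻¹) = disc x := by
  simp only [disc, alternation, mul_v, mul_m, inv_v, inv_m]
  ring

end TruncatedSeries

open TruncatedSeries

/-- The Magnus expansion of the free group of rank three, truncated above degree two. -/
def magnus : FreeGroupN 3 →* TruncatedSeries :=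
  FreeGroup.lift fun i => ⟨Pi.single i 1, 0⟩

@[simp] lemma magnus_of (i : Fin 3) : magnus (FreeGroup.of i) = ⟨Pi.single i 1, 0⟩ := by
  simp [magnus]

lemma map_eq_prod_zpow_magnus {C : Type*} [CommGroup C] (χ : FreeGroupN 3 →* C)
    (w : FreeGroupN 3) :
    χ w = ∏ i, χ (FreeGroup.of i) ^ (magnus w).v i := by
  induction w using FreeGroup.induction_on with
  | C1 => simp
  | of i => simp [Fin.prod_univ_three]; fin_cases i <;> simp
  | inv_of i ih => simp [ih, Finset.prod_inv_distrib]
  | mul x y hx hy => simp [hx, hy, zpow_add, Finset.prod_mul_distrib]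

lemma toAdd_map_eq_sum_magnus (χ : FreeGroupN 3 →* Multiplicative ℤ) (w : FreeGroupN 3) :
    (χ w).toAdd = ∑ i, (magnus w).v i * (χ (FreeGroup.of i)).toAdd := by
  rw [map_eq_prod_zpow_magnus χ w, toAdd_prod]
  simp

lemma exists_hom_int_ne_one (G : Type*) [Group G] [IsFreeGroup G] [Nontrivial G] :
    ∃ χ : G →* Multiplicative ℤ, χ ≠ 1 := by
  have : Nontrivial (FreeGroup (IsFreeGroup.Generators G)) :=
    (IsFreeGroup.toFreeGroup G).symm.toEquiv.nontrivial
  obtain ⟨s⟩ : Nonempty (IsFreeGroup.Generators G) := by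
    by_contra h
    rw [not_nonempty_iff] at h
    exact not_subsingleton (FreeGroup (IsFreeGroup.Generators G)) inferInstance
  refine ⟨IsFreeGroup.lift fun _ => Multiplicative.ofAdd 1, fun h => ?_⟩
  have := DFunLike.congr_fun h (IsFreeGroup.of s)
  rw [IsFreeGroup.lift_of, MonoidHom.one_apply] at this
  exact absurd this (by decide)

section FreeFactor

variable {G : Type*} [Group G] {A B : Subgroup G}

lemma exists_retractions (h : Function.Bijective (Monoid.Coprod.lift A.subtype B.subtype)) :
    ∃ (r : G →* A) (s : G →* B), (∀ a : A, r a = a) ∧ (∀ b : B, s b = b) ∧ ∀ a : A, s a = 1 := by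
  let e := MulEquiv.ofBijective _ h
  have hA (a : A) : e.symm a = Monoid.Coprod.inl a := by
    rw [MulEquiv.symm_apply_eq]; simp [e]
  have hB (b : B) : e.symm b = Monoid.Coprod.inr b := by
    rw [MulEquiv.symm_apply_eq]; simp [e]
  refine ⟨Monoid.Coprod.fst.comp e.symm.toMonoidHom, Monoid.Coprod.snd.comp e.symm.toMonoidHom,
    ?_, ?_, ?_⟩ <;> intro x <;> simp [hA, hB]

lemma ne_bot_of_bijective_lift (h : Function.Bijective (Monoid.Coprod.lift A.subtype B.subtype))
    (hA : A ≠ ⊤) : B ≠ ⊥ := by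
  rintro rfl
  refine hA (eq_top_iff.2 ?_)
  rw [← MonoidHom.range_eq_top.2 h.2, Monoid.Coprod.range_lift]
  simp

end FreeFactor

/-- Elements of a proper free factor with the same linear part have the same `disc`. -/
lemma IsFreeFactor.disc_magnus_eq {A : Subgroup (FreeGroupN 3)} (hA : IsFreeFactor A)
    (hA' : A ≠ ⊤) {x y : FreeGroupN 3} (hx : x ∈ A) (hy : y ∈ A)
    (h : (magnus y).v = (magnus x).v) : disc (magnus y) = disc (magnus x) := by
  obtain ⟨B, hB⟩ := hA
  obtain ⟨r, s, hr, hs, hsA⟩ := exists_retractions hB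
  have : Nontrivial B := B.nontrivial_iff_ne_bot.2 (ne_bot_of_bijective_lift hB hA')
  obtain ⟨χ, hχ⟩ := exists_hom_int_ne_one B
  let l : Fin 3 → ℤ := fun i => (χ (s (FreeGroup.of i))).toAdd
  have hl (w : FreeGroupN 3) : (χ (s w)).toAdd = ∑ i, (magnus w).v i * l i :=
    toAdd_map_eq_sum_magnus (χ.comp s) w
  have hl0 : l ≠ 0 := by
    intro h0
    refine hχ (MonoidHom.ext fun b => ?_)
    have := hl b
    simpa [hs, h0] using this
  have hlA (a : A) : ∑ i, (magnus a).v i * l i = 0 := by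
    rw [← hl, hsA]; simp
  have key (c : A) (hc : c ∈ commutator A) :
      (magnus c).v = 0 ∧ alternation (magnus x).v (magnus c).m = 0 := by
    rw [commutator_eq_closure] at hc
    induction hc using Subgroup.closure_induction with
    | mem c hc =>
      obtain ⟨p, q, rfl⟩ := hc
      have hdet : Matrix.det !![(magnus x).v 0, (magnus x).v 1, (magnus x).v 2;
          (magnus p).v 0, (magnus p).v 1, (magnus p).v 2;
          (magnus q).v 0, (magnus q).v 1, (magnus q).v 2] = 0 := by
        refine Matrix.exists_mulVec_eq_zero_iff.1 ⟨l, hl0, ?_⟩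
        have h1 := hlA ⟨x, hx⟩
        have h2 := hlA p
        have h3 := hlA q
        rw [Fin.sum_univ_three] at h1 h2 h3
        ext i
        fin_cases i <;> simpa [Matrix.mulVec, dotProduct, Fin.sum_univ_three]
      rw [Matrix.det_fin_three] at hdet
      simp at hdet
      constructor
      · ext i; simp [commutatorElement_def]
      · simp [commutatorElement_def, alternation]
        linear_combination 2 * hdet
    | one => simp [alternation, funext_iff]
    | mul c d _ _ hc hd =>
      simp only [Subgroup.coe_mul, map_mul]
      constructor
      · ext i; simp [hc.1, hd.1]
      · have h1 := hc.2
        have h2 := hd.2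
        simp only [alternation, mul_m, hc.1, Pi.zero_apply] at *
        linear_combination h1 + h2
    | inv c _ hc =>
      simp only [Subgroup.coe_inv, map_inv]
      constructor
      · ext i; simp [hc.1]
      · have h1 := hc.2
        simp only [alternation, inv_m, hc.1, Pi.zero_apply] at *
        linear_combination -h1
  let c : A := ⟨y * x⁻¹, A.mul_mem hy (A.inv_mem hx)⟩
  have hc : c ∈ commutator A := by
    rw [← Abelianization.ker_of, MonoidHom.mem_ker, ← hr c]
    have := map_eq_prod_zpow_magnus (Abelianization.of.comp r) c
    simpa [c, h] using this
  obtain ⟨hcv, hcm⟩ := key c hc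
  have hyc : magnus y = magnus c * magnus x := by simp [c]
  have hm (i j : Fin 3) :
      (magnus y).m i j = (magnus (c : FreeGroupN 3)).m i j + (magnus x).m i j := by
    simp [hyc, hcv]
  simp only [disc, alternation, h, hm] at hcm ⊢
  linear_combination hcm

lemma IsFreeFactor.exists_magnus_v_ne_zero {A : Subgroup (FreeGroupN 3)} (hA : IsFreeFactor A)
    (hA' : A ≠ ⊥) : ∃ x ∈ A, (magnus x).v ≠ 0 := by
  obtain ⟨B, hB⟩ := hA
  obtain ⟨r, -, hr, -⟩ := exists_retractions hB
  have : Nontrivial A := A.nontrivial_iff_ne_bot.2 hA'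
  obtain ⟨χ, hχ⟩ := exists_hom_int_ne_one A
  by_contra! h
  refine hχ (MonoidHom.ext fun a => ?_)
  have := map_eq_prod_zpow_magnus (χ.comp r) a
  simpa [hr, h a a.2] using this

/-- The automorphism `a ↦ b`, `b ↦ b⁻¹a⁻¹bac`, `c ↦ a` of `F₃ = ⟨a, b, c⟩`. -/
def exampleAut : MulAut (FreeGroupN 3) :=
  MonoidHom.toMulEquiv
    (FreeGroup.lift ![FreeGroup.of 1,
      (FreeGroup.of 1)⁻¹ * (FreeGroup.of 0)⁻¹ * FreeGroup.of 1 * FreeGroup.of 0 * FreeGroup.of 2,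
      FreeGroup.of 0])
    (FreeGroup.lift ![FreeGroup.of 2, FreeGroup.of 0,
      (FreeGroup.of 2)⁻¹ * (FreeGroup.of 0)⁻¹ * FreeGroup.of 2 * FreeGroup.of 0 * FreeGroup.of 1])
    (by ext i; fin_cases i <;> simp [mul_assoc])
    (by ext i; fin_cases i <;> simp [mul_assoc])

lemma exampleAut_of_zero : exampleAut (FreeGroup.of 0) = FreeGroup.of 1 := by
  simp [exampleAut]

lemma exampleAut_of_one : exampleAut (FreeGroup.of 1) =
    (FreeGroup.of 1)⁻¹ * (FreeGroup.of 0)⁻¹ * FreeGroup.of 1 * FreeGroup.of 0 *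
      FreeGroup.of 2 := by
  simp [exampleAut]

lemma exampleAut_of_two : exampleAut (FreeGroup.of 2) = FreeGroup.of 0 := by
  simp [exampleAut]

/-- The automorphism of the group of truncated series induced by `exampleAut`. -/
def exampleSeriesHom : TruncatedSeries →* TruncatedSeries :=
  MonoidHom.mk'
    (fun x => ⟨fun i => x.v (i - 1), fun i j => x.m (i - 1) (j - 1) +
      x.v 1 * (if i = 1 ∧ j = 0 then 1 else if i = 0 ∧ j = 1 then -1 else 0)⟩)
    (fun x y => by
      ext i j
      · simp
      · simp only [mul_v, mul_m]; ring)

lemma magnus_exampleAut (x : FreeGroupN 3) :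
    magnus (exampleAut x) = exampleSeriesHom (magnus x) := by
  suffices h : magnus.comp exampleAut.toMonoidHom = exampleSeriesHom.comp magnus from
    DFunLike.congr_fun h x
  refine FreeGroup.ext_hom _ _ fun i => ?_
  fin_cases i
  · simp [exampleAut_of_zero, exampleSeriesHom, TruncatedSeries.ext_iff, funext_iff]
    decide
  · simp [exampleAut_of_one, exampleSeriesHom, TruncatedSeries.ext_iff, funext_iff]
    decide
  · simp [exampleAut_of_two, exampleSeriesHom, TruncatedSeries.ext_iff, funext_iff]
    decide

lemma magnus_exampleAut_v (x : FreeGroupN 3) (i : Fin 3) :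
    (magnus (exampleAut x)).v i = (magnus x).v (i - 1) := by
  rw [magnus_exampleAut]; rfl

lemma disc_magnus_exampleAut (x : FreeGroupN 3) :
    disc (magnus (exampleAut x)) = disc (magnus x) - 2 * (magnus x).v 1 ^ 2 := by
  rw [magnus_exampleAut]
  have h0 : (0 : Fin 3) - 1 = 2 := rfl
  have h2 : (2 : Fin 3) - 1 = 1 := rfl
  simp [disc, alternation, exampleSeriesHom, h0, h2]
  ring

lemma magnus_exampleAut_pow_v (k : ℕ) (x : FreeGroupN 3) :
    (magnus ((exampleAut ^ (3 * k)) x)).v = (magnus x).v := by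
  induction k with
  | zero => simp
  | succ k ih =>
    rw [mul_add_one, add_comm, pow_add, MulAut.mul_apply, ← ih]
    ext i
    simp only [pow_succ, pow_zero, one_mul, MulAut.mul_apply, magnus_exampleAut_v]
    fin_cases i <;> rfl

lemma disc_magnus_exampleAut_pow (k : ℕ) (x : FreeGroupN 3) :
    disc (magnus ((exampleAut ^ (3 * k)) x)) =
      disc (magnus x) - 2 * k * ((magnus x).v 0 ^ 2 + (magnus x).v 1 ^ 2 + (magnus x).v 2 ^ 2) := by
  induction k with
  | zero => simp
  | succ k ih =>
    have h0 : (0 : Fin 3) - 1 = 2 := rfl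
    rw [mul_add_one, add_comm, pow_add, MulAut.mul_apply]
    simp only [pow_succ, pow_zero, one_mul, MulAut.mul_apply, magnus_exampleAut_v,
      disc_magnus_exampleAut, ih, magnus_exampleAut_pow_v, sub_self, h0]
    push_cast
    ring

/-- The quotient map from the automorphism group to the outer automorphism group. -/
def Out.mk (G : Type*) [Group G] : MulAut G →* Out G := QuotientGroup.mk' (Inn G)

lemma Out.exists_eq_conj_mul {G : Type*} [Group G] {f₁ f₂ : MulAut G}
    (h : Out.mk G f₁ = Out.mk G f₂) : ∃ g : G, f₁ = MulAut.conj g * f₂ := by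
  have : f₁ * f₂⁻¹ ∈ (Out.mk G).ker := by simp [MonoidHom.mem_ker, h]
  obtain ⟨g, hg⟩ : f₁ * f₂⁻¹ ∈ Inn G := by
    exact (QuotientGroup.ker_mk' (Inn G)).le this
  exact ⟨g, by rw [hg, inv_mul_cancel_right]⟩

lemma Out.mk_conj {G : Type*} [Group G] (g : G) : Out.mk G (MulAut.conj g) = 1 :=
  (QuotientGroup.eq_one_iff _).2 ⟨g, rfl⟩

lemma fullyIrreducible_exampleAut : FullyIrreducible (Out.mk (FreeGroupN 3) exampleAut) := by
  intro k hk f hf A hA hbot htop g hg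
  have hf : Out.mk (FreeGroupN 3) f = Out.mk _ exampleAut ^ k := hf
  let f' := MulAut.conj g⁻¹ * f
  have hmem {x : FreeGroupN 3} (hx : x ∈ A) : f' x ∈ A := by
    have : f x ∈ A.map (f : FreeGroupN 3 →* FreeGroupN 3) := Subgroup.mem_map_of_mem _ hx
    rw [hg] at this
    obtain ⟨y, hy, hyx⟩ := this
    have : f' x = y := by
      simp only [f', MulAut.mul_apply, MulAut.conj_apply]
      rw [← show g * y * g⁻¹ = f x from hyx]
      group
    rwa [this]
  obtain ⟨h, hh⟩ : ∃ h, f' ^ 3 = MulAut.conj h * exampleAut ^ (3 * k) := by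
    apply Out.exists_eq_conj_mul
    rw [map_pow, map_mul, Out.mk_conj, one_mul, hf, map_pow, ← pow_mul, mul_comm]
  obtain ⟨x, hx, hxv⟩ := hA.exists_magnus_v_ne_zero hbot
  have hy : (f' ^ 3) x ∈ A := hmem (hmem (hmem hx))
  rw [hh, MulAut.mul_apply, MulAut.conj_apply] at hy
  have hdisc := hA.disc_magnus_eq htop hx hy (by
    rw [map_mul, map_mul, map_inv, conj_v, magnus_exampleAut_pow_v])
  rw [map_mul, map_mul, map_inv, disc_conj, disc_magnus_exampleAut_pow] at hdisc
  have hk : (k : ℤ) ≠ 0 := by exact_mod_cast hk.ne'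
  have hsum : (magnus x).v 0 ^ 2 + (magnus x).v 1 ^ 2 + (magnus x).v 2 ^ 2 = 0 := by
    have : (k : ℤ) * ((magnus x).v 0 ^ 2 + (magnus x).v 1 ^ 2 + (magnus x).v 2 ^ 2) = 0 := by
      linarith
    exact (mul_eq_zero.1 this).resolve_left hk
  have h0 : (magnus x).v 0 = 0 := by nlinarith
  have h1 : (magnus x).v 1 = 0 := by nlinarith
  have h2 : (magnus x).v 2 = 0 := by nlinarith
  refine hxv (funext fun i => ?_)
  fin_cases i <;> assumption

/-- The automorphism of `F₃ = ⟨a, b, c⟩` given by `a ↦ b`, `b ↦ b⁻¹a⁻¹bac`, `c ↦ a`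
(with `a = of 0`, `b = of 1`, `c = of 2`) exists and is fully irreducible in `Out(F₃)`. -/
theorem example_fully_irreducible :
    ∃ ψ : MulAut (FreeGroupN 3),
      ψ (FreeGroup.of 0) = FreeGroup.of 1 ∧
      ψ (FreeGroup.of 1) =
        (FreeGroup.of 1)⁻¹ * (FreeGroup.of 0)⁻¹ * FreeGroup.of 1 * FreeGroup.of 0 *
          FreeGroup.of 2 ∧
      ψ (FreeGroup.of 2) = FreeGroup.of 0 ∧
      FullyIrreducible (QuotientGroup.mk ψ : Out (FreeGroupN 3)) := by
  exact ⟨exampleAut, exampleAut_of_zero, exampleAut_of_one, exampleAut_of_two,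
    fullyIrreducible_exampleAut⟩
end

section
/- There exist an integer N ≥ 2 and a fully irreducible outer automorphism φ ∈ Out(F_N) of the free group F_N of rank N such that λ(φ) ≠ λ(φ⁻¹), i.e., the stretch factors of φ and of its inverse are different. -/
namespace FreeGroup

variable {α : Type*} [DecidableEq α]

theorem IsReduced.norm_mk {u : List (α × Bool)} (h : IsReduced u) : norm (mk u) = u.length := by
  rw [norm, toWord_mk, h.reduce_eq]

/-- The reduced word of a product is obtained by cancelling a suffix of the first reduced word
against a prefix of the second. -/
theorem exists_toWord_mul (g h : FreeGroup α) :
    ∃ a b c : List (α × Bool), g.toWord = a ++ b ∧ h.toWord = invRev b ++ c ∧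
      (g * h).toWord = a ++ c := by
  suffices H : ∀ u v : List (α × Bool), IsReduced u → IsReduced v →
      ∃ a b c : List (α × Bool), u = a ++ b ∧ v = invRev b ++ c ∧ IsReduced (a ++ c) by
    obtain ⟨a, b, c, h1, h2, h3⟩ := H _ _ (isReduced_toWord (x := g)) (isReduced_toWord (x := h))
    refine ⟨a, b, c, h1, h2, ?_⟩
    rw [← h3.reduce_eq, ← toWord_mk]
    congr 1
    rw [← mk_toWord (x := g), ← mk_toWord (x := h), h1, h2]
    simp only [← mul_mk, ← inv_mk]
    group
  intro u
  induction u using List.reverseRecOn with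
  | nil => exact fun v _ hv => ⟨[], [], v, rfl, rfl, hv⟩
  | append_singleton u x ih =>
    intro v hu hv
    cases v with
    | nil => exact ⟨u ++ [x], [], [], by simp, rfl, by simpa using hu⟩
    | cons y v =>
      by_cases hxy : x.1 = y.1 → x.2 = y.2
      · refine ⟨u ++ [x], [], y :: v, by simp, rfl, ?_⟩
        refine IsReduced.append_overlap hu ?_ (by simp)
        exact List.isChain_cons_cons.2 ⟨hxy, hv⟩
      · obtain ⟨a, b, c, h1, h2, h3⟩ := ih v (hu.infix ⟨[], [x], by simp⟩)
          (hv.infix ⟨[y], [], by simp⟩)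
        refine ⟨a, b ++ [x], c, by simp [h1], ?_, h3⟩
        push Not at hxy
        obtain ⟨x1, x2⟩ := x
        obtain ⟨y1, y2⟩ := y
        simp only at hxy
        obtain ⟨rfl, h⟩ := hxy
        have : y2 = !x2 := by cases x2 <;> cases y2 <;> simp_all
        simp [h2, this, invRev]

omit [DecidableEq α] in
/-- Letterwise Lipschitz bound for a homomorphism between free groups. -/
theorem norm_map_mk_le {β : Type*} [DecidableEq β] (f : FreeGroup α →* FreeGroup β) {K : ℕ}
    (hK : ∀ x : α × Bool, norm (f (mk [x])) ≤ K) (u : List (α × Bool)) :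
    norm (f (mk u)) ≤ K * u.length := by
  induction u with
  | nil => simp [← one_eq_mk]
  | cons x u ih =>
    have : mk (x :: u) = mk [x] * mk u := by simp
    rw [this, _root_.map_mul]
    refine (norm_mul_le _ _).trans ?_
    have := hK x
    simp only [List.length_cons]
    linarith

theorem exists_norm_map_le [Finite α] {β : Type*} [DecidableEq β]
    (f : FreeGroup α →* FreeGroup β) :
    ∃ K : ℕ, 0 < K ∧ ∀ g, norm (f g) ≤ K * norm g := by
  obtain ⟨K, hK⟩ := (Set.finite_range fun x : α × Bool => norm (f (mk [x]))).bddAbove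
  refine ⟨K + 1, by simp, fun g => ?_⟩
  have := norm_map_mk_le f (K := K + 1)
    (fun x => (hK ⟨x, rfl⟩).trans (Nat.le_succ _)) g.toWord
  rwa [mk_toWord] at this

omit [DecidableEq α] in
/-- A path in the Cayley tree from `1` to `f u` passes close to every prefix of `f u`. -/
theorem exists_prefix_norm_le {β : Type*} [DecidableEq β] (f : FreeGroup α →* FreeGroup β) {K : ℕ}
    (hK : ∀ x : α × Bool, norm (f (mk [x])) ≤ K) (u : List (α × Bool)) (y : List (β × Bool))
    (hy : y <+: (f (mk u)).toWord) :
    ∃ v, v <+: u ∧ norm ((mk y)⁻¹ * f (mk v)) ≤ K := by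
  induction u using List.reverseRecOn with
  | nil =>
    refine ⟨[], List.prefix_rfl, ?_⟩
    simp [← one_eq_mk] at hy
    simp [hy, ← one_eq_mk]
  | append_singleton u x ih =>
    by_cases h : y <+: (f (mk u)).toWord
    · obtain ⟨v, hv, h⟩ := ih h
      exact ⟨v, hv.trans (List.prefix_append _ _), h⟩
    refine ⟨u, List.prefix_append _ _, ?_⟩
    rw [← mul_mk, _root_.map_mul] at hy
    obtain ⟨a, b, c, h1, h2, h3⟩ := exists_toWord_mul (f (mk u)) (f (mk [x]))
    rw [h3] at hy
    rw [h1] at h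
    have ha : ¬ y <+: a := fun h' => h (h'.trans (List.prefix_append _ _))
    rcases List.prefix_or_prefix_of_prefix hy (List.prefix_append a c) with h' | ⟨d, rfl⟩
    · exact absurd h' ha
    have hd : d <+: c := (List.prefix_append_right_inj a).1 hy
    have e : (mk (a ++ d))⁻¹ * f (mk u) = mk (invRev d ++ b) := by
      rw [← mk_toWord (x := f (mk u)), h1, ← mul_mk, ← mul_mk, ← mul_mk, ← inv_mk]
      group
    rw [e]
    have := hK x
    rw [norm, h2] at this
    refine norm_mk_le.trans (le_trans ?_ this)
    have := hd.length_le
    simp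
    omega

/-- Cooper's bounded cancellation lemma. -/
theorem bounded_cancellation [Finite α] (f : MulAut (FreeGroup α)) :
    ∃ C : ℕ, ∀ u v : List (α × Bool), IsReduced (u ++ v) →
      norm (f (mk u)) + norm (f (mk v)) ≤ norm (f (mk (u ++ v))) + 2 * C := by
  obtain ⟨K, -, hK⟩ := exists_norm_map_le (f : FreeGroup α →* FreeGroup α)
  obtain ⟨K', -, hK'⟩ :=
    exists_norm_map_le ((f⁻¹ : MulAut (FreeGroup α)) : FreeGroup α →* FreeGroup α)
  have hK1 : ∀ x : α × Bool, norm ((f : FreeGroup α →* FreeGroup α) (mk [x])) ≤ K := fun x =>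
    (hK _).trans (by simpa using Nat.mul_le_mul_left K (norm_mk_le (L₁ := [x])))
  refine ⟨K + K * (K' * (2 * K)), fun u v huv => ?_⟩
  obtain ⟨a, b, c, h1, h2, h3⟩ := exists_toWord_mul (f (mk u)) (f (mk v))
  have hb : b.length ≤ K + K * (K' * (2 * K)) := by
    obtain ⟨v', hv', hv''⟩ := exists_prefix_norm_le (f : FreeGroup α →* FreeGroup α) hK1 v (invRev b)
      (by simp [h2])
    obtain ⟨u', hu', hu''⟩ := exists_prefix_norm_le (f : FreeGroup α →* FreeGroup α) hK1 (invRev u)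
      (invRev b) (by
        rw [← inv_mk, _root_.map_inv, toWord_inv]
        simp [h1, invRev_append])
    have hs : invRev u' ++ v' <:+: u ++ v := by
      obtain ⟨s, hs⟩ := hu'
      obtain ⟨t, ht⟩ := hv'
      refine ⟨invRev s, t, ?_⟩
      rw [← invRev_invRev (L₁ := u), ← hs, ← ht, invRev_append]
      simp
    have hr := (huv.infix hs).norm_mk
    have hn : norm (f (mk (invRev u' ++ v'))) ≤ 2 * K := by
      have : f (mk (invRev u' ++ v')) =
          ((mk (invRev b))⁻¹ * f (mk u'))⁻¹ * ((mk (invRev b))⁻¹ * f (mk v')) := by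
        rw [← mul_mk, ← inv_mk, _root_.map_mul, _root_.map_inv]
        group
      rw [this]
      refine (norm_mul_le _ _).trans ?_
      rw [norm_inv_eq]
      simp only [MonoidHom.coe_coe] at hv'' hu''
      omega
    have hl : (invRev u' ++ v').length ≤ K' * (2 * K) := by
      rw [← hr]
      have := hK' (f (mk (invRev u' ++ v')))
      simp only [MonoidHom.coe_coe, MulAut.inv_apply_self] at this
      exact this.trans (Nat.mul_le_mul_left _ hn)
    have hv1 : norm (f (mk v')) ≤ K * (K' * (2 * K)) := by
      refine (hK _).trans (Nat.mul_le_mul_left _ (norm_mk_le.trans (le_trans ?_ hl)))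
      simp
    have hbr : IsReduced (invRev b) := (isReduced_toWord (x := f (mk v))).infix
      ⟨[], c, by simp [h2]⟩
    have := norm_mul_le (f (mk v')) ((mk (invRev b))⁻¹ * f (mk v'))⁻¹
    rw [norm_inv_eq, mul_inv_rev, mul_inv_cancel_left, inv_inv, hbr.norm_mk, invRev_length] at this
    simp only [MonoidHom.coe_coe] at hv''
    omega
  rw [← mul_mk, _root_.map_mul]
  simp only [norm, h1, h2, h3, List.length_append, invRev_length]
  omega

section IllegalTurns

variable {β : Type*} (r : β → β → Prop)

open Classical in
/-- The number of consecutive pairs of letters of a word which are not related by `r`. -/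
noncomputable def illegalTurns : List β → ℕ
  | [] => 0
  | [_] => 0
  | x :: y :: t => (if r x y then 0 else 1) + illegalTurns (y :: t)

theorem illegalTurns_append_cons (u : List β) (x : β) (v : List β) :
    illegalTurns r (u ++ x :: v) = illegalTurns r (u ++ [x]) + illegalTurns r (x :: v) := by
  induction u with
  | nil => simp [illegalTurns]
  | cons a u ih => cases u <;> simp_all [illegalTurns, add_assoc]

theorem illegalTurns_le_cons (x : β) (v : List β) :
    illegalTurns r v ≤ illegalTurns r (x :: v) := by
  cases v <;> simp [illegalTurns]

theorem illegalTurns_le_append_left (u v : List β) :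
    illegalTurns r v ≤ illegalTurns r (u ++ v) := by
  induction u with
  | nil => rfl
  | cons a u ih => exact ih.trans (illegalTurns_le_cons r a _)

theorem illegalTurns_le_append_right (u v : List β) :
    illegalTurns r u ≤ illegalTurns r (u ++ v) := by
  cases u using List.reverseRecOn with
  | nil => simp [illegalTurns]
  | append_singleton u x =>
    rw [List.append_assoc, List.singleton_append, illegalTurns_append_cons r u x v]
    exact Nat.le_add_right _ _

theorem illegalTurns_le_of_infix {u v : List β} (h : u <:+: v) :
    illegalTurns r u ≤ illegalTurns r v := by
  obtain ⟨s, t, rfl⟩ := h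
  exact (illegalTurns_le_append_left r s u).trans (illegalTurns_le_append_right r _ t)

variable {r}

theorem illegalTurns_eq_zero {u : List β} (h : u.IsChain r) : illegalTurns r u = 0 := by
  induction h with
  | nil => rfl
  | singleton => rfl
  | cons_cons hr _ ih => simp [illegalTurns, hr, ih]

theorem exists_isChain_prefix (x : β) (u : List β) :
    ∃ p t, u = p ++ t ∧ (x :: p).IsChain r ∧
      (t = [] ∨ illegalTurns r t + 1 ≤ illegalTurns r (x :: u)) := by
  induction u generalizing x with
  | nil => exact ⟨[], [], by simp⟩
  | cons y u ih =>
    by_cases h : r x y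
    · obtain ⟨p, t, rfl, hp, ht⟩ := ih y
      exact ⟨y :: p, t, rfl, List.isChain_cons_cons.2 ⟨h, hp⟩, by simpa [illegalTurns, h] using ht⟩
    · exact ⟨[], y :: u, rfl, by simp, Or.inr (by simp [illegalTurns, h, add_comm])⟩

/-- A long word with few illegal turns contains a long legal subword. -/
theorem exists_isChain_infix (B m : ℕ) (u : List β) (hu : illegalTurns r u ≤ m)
    (hl : (m + 1) * B < u.length) : ∃ s p t, u = s ++ p ++ t ∧ p.IsChain r ∧ B < p.length := by
  induction m generalizing u with
  | zero =>
    cases u with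
    | nil => simp at hl
    | cons x u =>
      obtain ⟨p, t, rfl, hp, ht⟩ := exists_isChain_prefix (r := r) x u
      rcases ht with rfl | ht
      · exact ⟨[], x :: p, [], by simp, hp, by simpa using hl⟩
      · omega
  | succ m ih =>
    cases u with
    | nil => simp at hl
    | cons x u =>
      obtain ⟨p, t, rfl, hp, ht⟩ := exists_isChain_prefix (r := r) x u
      by_cases hB : B < (x :: p).length
      · exact ⟨[], x :: p, t, by simp, hp, hB⟩
      rcases ht with rfl | ht
      · simp only [List.append_nil] at hl
        nlinarith
      · obtain ⟨s, q, t', rfl, hq, hq'⟩ := ih t (by omega) (by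
          simp only [List.length_cons, List.length_append] at hl hB
          nlinarith)
        exact ⟨x :: p ++ s, q, t', by simp, hq, hq'⟩

end IllegalTurns

omit [DecidableEq α] in
theorem illegalTurns_le_of_step {r : α × Bool → α × Bool → Prop}
    (hr : ∀ x y, r x y → x.1 = y.1 → x.2 = y.2) {u v : List (α × Bool)} (h : Red.Step u v) :
    illegalTurns r v ≤ illegalTurns r u := by
  obtain @⟨u, v, x, b⟩ := h
  have hx : ¬ r (x, b) (x, !b) := fun h => by simpa using hr _ _ h rfl
  cases u using List.reverseRecOn with
  | nil => simpa using (illegalTurns_le_append_left r [(x, b), (x, !b)] v)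
  | append_singleton u a =>
    simp only [List.append_assoc, List.singleton_append]
    rw [illegalTurns_append_cons r u a v, illegalTurns_append_cons r u a (_ :: _)]
    cases v with
    | nil => simp [illegalTurns]
    | cons c v =>
      simp only [illegalTurns, hx, if_false]
      split_ifs <;> omega

omit [DecidableEq α] in
theorem illegalTurns_le_of_red {r : α × Bool → α × Bool → Prop}
    (hr : ∀ x y, r x y → x.1 = y.1 → x.2 = y.2) {u v : List (α × Bool)} (h : Red u v) :
    illegalTurns r v ≤ illegalTurns r u := by
  induction h with
  | refl => rfl
  | tail _ h ih => exact (illegalTurns_le_of_step hr h).trans ih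

/-- A train track representative, on the rose, of an automorphism of a free group, with
a notion of legal turns and a length function for which edges are stretched by `lam`. -/
structure RoseTrainTrack (f : MulAut (FreeGroup α)) (lam : ℝ) where
  intro ::
  /-- The image of each oriented edge, as an edge path. -/
  image : α × Bool → List (α × Bool)
  /-- The relation saying that one oriented edge may follow another in a legal path. -/
  legal : α × Bool → α × Bool → Prop
  /-- The length of each oriented edge. -/
  len : α × Bool → ℝ
  map_mk : ∀ x, f (mk [x]) = mk (image x)
  isChain_image : ∀ x, (image x).IsChain legal
  image_ne_nil : ∀ x, image x ≠ []
  legal_image : ∀ x y, legal x y → ∀ a ∈ (image x).getLast?, ∀ b ∈ (image y).head?, legal a b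
  reduced_of_legal : ∀ x y, legal x y → x.1 = y.1 → x.2 = y.2
  len_pos : ∀ x, 0 < len x
  len_image : ∀ x, ((image x).map len).sum = lam * len x

namespace RoseTrainTrack

variable {f : MulAut (FreeGroup α)} {lam : ℝ} (T : RoseTrainTrack f lam)

omit [DecidableEq α]

/-- The total length of an edge path. -/
def pathLen (u : List (α × Bool)) : ℝ := (u.map T.len).sum

@[simp]
theorem pathLen_append (u v : List (α × Bool)) :
    T.pathLen (u ++ v) = T.pathLen u + T.pathLen v := by simp [pathLen]

theorem pathLen_flatMap (u : List (α × Bool)) :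
    T.pathLen (u.flatMap T.image) = lam * T.pathLen u := by
  induction u with
  | nil => simp [pathLen]
  | cons x u ih =>
    rw [List.flatMap_cons, pathLen_append, ih]
    simp only [pathLen, List.map_cons, List.sum_cons, T.len_image]
    ring

theorem map_mk_flatMap (u : List (α × Bool)) : f (mk u) = mk (u.flatMap T.image) := by
  induction u with
  | nil => simp [← one_eq_mk]
  | cons x u ih =>
    rw [← List.singleton_append, ← mul_mk, _root_.map_mul, ih, T.map_mk, List.flatMap_append,
      ← mul_mk]
    simp

theorem pathLen_le {M : ℝ} (hM : ∀ x, T.len x ≤ M) (u : List (α × Bool)) :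
    T.pathLen u ≤ M * u.length := by
  induction u with
  | nil => simp [pathLen]
  | cons x u ih =>
    have := hM x
    simp only [pathLen, List.map_cons, List.sum_cons, List.length_cons] at ih ⊢
    push_cast
    linarith

theorem le_pathLen {M : ℝ} (hM : ∀ x, M ≤ T.len x) (u : List (α × Bool)) :
    M * u.length ≤ T.pathLen u := by
  induction u with
  | nil => simp [pathLen]
  | cons x u ih =>
    have := hM x
    simp only [pathLen, List.map_cons, List.sum_cons, List.length_cons] at ih ⊢
    push_cast
    linarith

theorem isReduced_of_isChain {u : List (α × Bool)} (h : u.IsChain T.legal) : IsReduced u :=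
  h.imp T.reduced_of_legal

theorem illegalTurns_flatMap_le (u : List (α × Bool)) :
    illegalTurns T.legal (u.flatMap T.image) ≤ illegalTurns T.legal u := by
  induction u with
  | nil => simp [illegalTurns]
  | cons x u ih =>
    cases u with
    | nil => simp [illegalTurns, illegalTurns_eq_zero (T.isChain_image x)]
    | cons y u =>
      obtain ⟨s, a, hs⟩ := (List.eq_nil_or_concat (T.image x)).resolve_left (T.image_ne_nil x)
      obtain ⟨b, t, ht⟩ := List.exists_cons_of_ne_nil (T.image_ne_nil y)
      have h0 := illegalTurns_eq_zero (T.isChain_image x)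
      have hl := T.legal_image x y
      rw [List.flatMap_cons, hs]
      rw [List.flatMap_cons, ht] at ih ⊢
      rw [hs] at h0
      rw [hs, ht] at hl
      simp only [List.append_assoc, List.cons_append, List.nil_append, List.concat_eq_append] at *
      rw [illegalTurns_append_cons, h0]
      simp only [illegalTurns] at ih ⊢
      simp at hl
      split_ifs <;> first | omega | tauto

theorem isChain_flatMap {u : List (α × Bool)} (h : u.IsChain T.legal) :
    (u.flatMap T.image).IsChain T.legal := by
  induction h with
  | nil => simp
  | singleton => simpa using T.isChain_image _
  | @cons_cons x y u hr _ ih =>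
    rw [List.flatMap_cons, List.isChain_append]
    refine ⟨T.isChain_image x, ih, fun a ha b hb => T.legal_image x y hr a ha b ?_⟩
    obtain ⟨c, t, ht⟩ := List.exists_cons_of_ne_nil (T.image_ne_nil y)
    rw [List.flatMap_cons, ht] at hb
    rw [ht]
    simpa using hb

/-- The conjugacy class `c` has a cyclically reduced representative containing a legal subword of
length at least `ℓ`. -/
def HasLongLegal (c : ConjClasses (FreeGroup α)) (ℓ : ℝ) : Prop :=
  ∃ p q : List (α × Bool), p.IsChain T.legal ∧ IsReduced (p ++ q ++ p) ∧
    ConjClasses.mk (mk (p ++ q)) = c ∧ ℓ ≤ T.pathLen p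

theorem hasLongLegal_map [DecidableEq α] {C : ℕ} (hC : ∀ u v : List (α × Bool), IsReduced (u ++ v) →
      norm (f (mk u)) + norm (f (mk v)) ≤ norm (f (mk (u ++ v))) + 2 * C)
    {M : ℝ} (hM : ∀ x, T.len x ≤ M) (hM0 : 0 < M) (hlam : 0 < lam) {c : ConjClasses (FreeGroup α)}
    {ℓ : ℝ} (h : T.HasLongLegal c ℓ) (hℓ : 4 * C * M ≤ lam * ℓ) :
    T.HasLongLegal (ConjClasses.map (f : FreeGroup α →* FreeGroup α) c) (lam * ℓ - 4 * C * M) := by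
  obtain ⟨p, q, hp, hr, rfl, hl⟩ := h
  have hPc := T.isChain_flatMap hp
  have hPl := T.pathLen_flatMap p
  have hfp := T.map_mk_flatMap p
  set P := p.flatMap T.image with hP
  have hPw : (f (mk p)).toWord = P := by
    rw [hfp, toWord_mk, (T.isReduced_of_isChain hPc).reduce_eq]
  have hPn : norm (f (mk p)) = P.length := by rw [norm, hPw]
  have hlen : 4 * C ≤ P.length := by
    have h1 := T.pathLen_le hM P
    have h2 : lam * ℓ ≤ lam * T.pathLen p := by gcongr
    have : (4 * C : ℝ) * M ≤ P.length * M := by linarith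
    exact_mod_cast le_of_mul_le_mul_right this hM0
  set x := P.take (2 * C) with hx
  set m := (P.drop (2 * C)).take (P.length - 4 * C) with hm
  set y := (P.drop (2 * C)).drop (P.length - 4 * C) with hy
  have hxl : x.length = 2 * C := by simp [hx]; omega
  have hml : m.length = P.length - 4 * C := by simp [hm]; omega
  have hyl : y.length = 2 * C := by simp [hy]; omega
  have hPd : P = x ++ m ++ y := by simp [hx, hm, hy]
  clear_value x m y
  set Z := (f (mk (p ++ q ++ p))).toWord with hZ
  have hr2 : IsReduced (p ++ (q ++ p)) := by simpa using hr
  have hpre : x ++ m <+: Z := by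
    obtain ⟨a, b, c, h1, h2, h3⟩ := exists_toWord_mul (f (mk p)) (f (mk (q ++ p)))
    have h4 := hC p (q ++ p) hr2
    rw [← mul_mk (L₁ := p), _root_.map_mul] at h4
    simp only [norm, h1, h2, h3, List.length_append, invRev_length] at h4
    have h5 : Z = a ++ c := by
      rw [hZ, List.append_assoc, ← mul_mk, _root_.map_mul, h3]
    rw [hPw, hPd] at h1
    rw [h5]
    refine List.IsPrefix.trans ?_ (List.prefix_append _ _)
    refine List.prefix_of_prefix_length_le (List.prefix_append (x ++ m) y)
      (h1 ▸ List.prefix_append a b) ?_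
    have := congrArg List.length h1
    simp only [List.length_append] at this ⊢
    omega
  have hsuf : m ++ y <:+ Z := by
    obtain ⟨a, b, c, h1, h2, h3⟩ := exists_toWord_mul (f (mk (p ++ q))) (f (mk p))
    have h4 := hC (p ++ q) p hr
    rw [← mul_mk (L₁ := p ++ q), _root_.map_mul] at h4
    simp only [norm, h1, h2, h3, List.length_append, invRev_length] at h4
    have h5 : Z = a ++ c := by
      rw [hZ, ← mul_mk (L₁ := p ++ q), _root_.map_mul, h3]
    rw [hPw, hPd] at h2
    rw [h5]
    refine List.IsSuffix.trans ?_ (List.suffix_append _ _)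
    refine List.suffix_of_suffix_length_le (l₃ := x ++ m ++ y)
      ⟨x, by simp⟩ (h2 ▸ List.suffix_append _ c) ?_
    have := congrArg List.length h2
    simp only [List.length_append, invRev_length] at this ⊢
    omega
  have hZl : 2 * P.length - 4 * C ≤ Z.length := by
    have h1 := hC p (q ++ p) hr2
    have h2 := hC q p (hr2.infix ⟨p, [], by simp⟩)
    rw [hPn] at h1 h2
    rw [← List.append_assoc] at h1
    change _ ≤ Z.length + _ at h1
    omega
  obtain ⟨s, hs⟩ := hsuf
  obtain ⟨r, hr'⟩ : x ++ m <+: s := by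
    refine List.prefix_of_prefix_length_le hpre ⟨m ++ y, hs⟩ ?_
    have := congrArg List.length hs
    simp only [List.length_append] at this ⊢
    omega
  have hZd : Z = x ++ m ++ r ++ (m ++ y) := by rw [← hs, ← hr']
  refine ⟨m, r, hPc.infix ⟨x, y, hPd.symm⟩, ?_, ?_, ?_⟩
  · exact (isReduced_toWord (x := f (mk (p ++ q ++ p)))).infix ⟨x, y, by
      rw [← hZ, hZd]; simp⟩
  · have h1 : f (mk (p ++ q)) = mk Z * (f (mk p))⁻¹ := by
      rw [hZ, mk_toWord, ← mul_mk (L₁ := p ++ q), _root_.map_mul]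
      group
    change _ = ConjClasses.mk (f (mk (p ++ q)))
    rw [h1, hfp, hZd, hPd, ConjClasses.mk_eq_mk_iff_isConj, isConj_iff]
    refine ⟨mk x, ?_⟩
    simp only [← mul_mk]
    group
  · have h1 : T.pathLen P = T.pathLen x + T.pathLen m + T.pathLen y := by
      rw [hPd, pathLen_append, pathLen_append]
    have h2 := T.pathLen_le hM x
    have h3 := T.pathLen_le hM y
    rw [hxl] at h2
    rw [hyl] at h3
    push_cast at h2 h3
    have h4 : lam * ℓ ≤ lam * T.pathLen p := by gcongr
    linarith

end RoseTrainTrack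

end FreeGroup

namespace FreeGroup

theorem exists_isCyclicallyReduced {α : Type*} {r : α × Bool → α × Bool → Prop}
    (hr : ∀ x y, r x y → x.1 = y.1 → x.2 = y.2) (u : List (α × Bool)) :
    ∃ v, IsCyclicallyReduced v ∧ ConjClasses.mk (mk v) = ConjClasses.mk (mk u) ∧
      illegalTurns r v ≤ illegalTurns r u := by
  classical
  have h := reduceCyclically.conj_conjugator_reduceCyclically (reduce u)
  refine ⟨reduceCyclically (reduce u), reduceCyclically.isCyclicallyReduced ?_, ?_, ?_⟩
  · rw [← toWord_mk]
    exact isReduced_toWord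
  · rw [ConjClasses.mk_eq_mk_iff_isConj, isConj_iff]
    refine ⟨mk (reduceCyclically.conjugator (reduce u)), ?_⟩
    rw [inv_mk, mul_mk, mul_mk, h, reduce.self]
  · exact (illegalTurns_le_of_infix r ⟨_, _, h⟩).trans (illegalTurns_le_of_red hr reduce.red)

/-- Cyclically reduced words have minimal length in their conjugacy class. -/
theorem IsCyclicallyReduced.length_le_norm {α : Type*} [DecidableEq α] {u : List (α × Bool)}
    (hu : IsCyclicallyReduced u) {h : FreeGroup α} (hh : IsConj h (mk u)) :
    u.length ≤ norm h := by
  obtain ⟨c, hc⟩ := isConj_iff.1 hh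
  by_contra! hlt
  set k := 2 * norm c + 1 with hk
  have h1 : norm (mk u ^ k) = k * u.length := by
    rw [pow_mk, (hu.flatten_replicate k).isReduced.norm_mk]
    simp
  have hpow : ∀ n, norm (h ^ n) ≤ n * norm h := by
    intro n
    induction n with
    | zero => simp
    | succ n ih =>
      rw [pow_succ]
      refine (norm_mul_le _ _).trans ?_
      linarith
  have h2 : norm (mk u ^ k) ≤ norm c + k * norm h + norm c := by
    rw [← hc, conj_pow]
    refine (norm_mul_le _ _).trans ?_
    rw [norm_inv_eq]
    have := norm_mul_le c (h ^ k)
    have := hpow k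
    omega
  have h3 : k * (norm h + 1) ≤ k * u.length := Nat.mul_le_mul_left _ hlt
  have h4 : k * (norm h + 1) = k * norm h + k := by ring
  omega

theorem isCyclicallyReduced_of_append {α : Type*} {p q : List (α × Bool)} (hp : p ≠ [])
    (h : IsReduced (p ++ q ++ p)) : IsCyclicallyReduced (p ++ q) := by
  refine ⟨h.infix ⟨[], p, by simp⟩, fun a ha b hb => ?_⟩
  refine (List.isChain_append.1 h).2.2 a ha b ?_
  rwa [List.head?_append_of_ne_nil _ hp] at hb

end FreeGroup

theorem ConjClasses.map_pow_succ {G : Type*} [Group G] (f : MulAut G) (n : ℕ)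
    (c : ConjClasses G) :
    ConjClasses.map ((f ^ (n + 1) : MulAut G) : G →* G) c =
      ConjClasses.map (f : G →* G) (ConjClasses.map ((f ^ n : MulAut G) : G →* G) c) := by
  obtain ⟨g, rfl⟩ := ConjClasses.exists_rep c
  rw [pow_succ']
  rfl

theorem ConjClasses.map_pow_add {G : Type*} [Group G] (f : MulAut G) (m n : ℕ)
    (c : ConjClasses G) :
    ConjClasses.map ((f ^ (m + n) : MulAut G) : G →* G) c =
      ConjClasses.map ((f ^ m : MulAut G) : G →* G)
        (ConjClasses.map ((f ^ n : MulAut G) : G →* G) c) := by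
  obtain ⟨g, rfl⟩ := ConjClasses.exists_rep c
  rw [pow_add]
  rfl

theorem ConjClasses.map_mulAut_injective {G : Type*} [Group G] (f : MulAut G) :
    Function.Injective (ConjClasses.map (f : G →* G)) := by
  refine Function.LeftInverse.injective (g := ConjClasses.map ((f⁻¹ : MulAut G) : G →* G)) ?_
  intro c
  obtain ⟨g, rfl⟩ := ConjClasses.exists_rep c
  exact congrArg ConjClasses.mk (MulAut.inv_apply_self G f g)

/-- Automorphisms with the same outer class induce the same map on conjugacy classes. -/
theorem ConjClasses.map_eq_of_mk_eq {G : Type*} [Group G] {f g : MulAut G}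
    (h : (QuotientGroup.mk f : Out G) = QuotientGroup.mk g) (c : ConjClasses G) :
    ConjClasses.map (f : G →* G) c = ConjClasses.map (g : G →* G) c := by
  obtain ⟨y, hy⟩ := QuotientGroup.eq.1 h
  obtain ⟨x, rfl⟩ := ConjClasses.exists_rep c
  change ConjClasses.mk (f x) = ConjClasses.mk (g x)
  rw [ConjClasses.mk_eq_mk_iff_isConj, isConj_iff]
  refine ⟨f y, ?_⟩
  have : g = f * MulAut.conj y := by rw [hy]; group
  simp [this]

theorem tendsto_rpow_one_div_of_bounds {a : ℕ → ℝ} {lam c C : ℝ} (hlam : 0 < lam) (hc : 0 < c)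
    (hC : 0 < C) (n₀ : ℕ) (h1 : ∀ n, n₀ ≤ n → c * lam ^ n ≤ a n) (h2 : ∀ n, a n ≤ C * lam ^ n) :
    Filter.Tendsto (fun n : ℕ => a n ^ (1 / (n : ℝ))) Filter.atTop (nhds lam) := by
  have key : ∀ b : ℝ, 0 < b →
      Filter.Tendsto (fun n : ℕ => (b * lam ^ n) ^ (1 / (n : ℝ))) Filter.atTop (nhds lam) := by
    intro b hb
    have h : Filter.Tendsto (fun n : ℕ => b ^ (1 / (n : ℝ)) * lam) Filter.atTop
        (nhds (b ^ (0 : ℝ) * lam)) :=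
      ((Real.continuousAt_const_rpow hb.ne').tendsto.comp
        tendsto_one_div_atTop_nhds_zero_nat).mul_const _
    rw [Real.rpow_zero, one_mul] at h
    refine h.congr' ?_
    filter_upwards [Filter.eventually_gt_atTop 0] with n hn
    rw [Real.mul_rpow hb.le (by positivity), one_div, Real.pow_rpow_inv_natCast hlam.le hn.ne']
  refine tendsto_of_tendsto_of_tendsto_of_le_of_le' (key c hc) (key C hC) ?_ ?_
  · filter_upwards [Filter.eventually_ge_atTop n₀] with n hn
    exact Real.rpow_le_rpow (by positivity) (h1 n hn) (by positivity)
  · filter_upwards [Filter.eventually_ge_atTop n₀] with n hn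
    exact Real.rpow_le_rpow (le_trans (by positivity) (h1 n hn)) (h2 n) (by positivity)

namespace FreeGroup.RoseTrainTrack

variable {N : ℕ} {f : MulAut (FreeGroupN N)} {lam : ℝ} (T : RoseTrainTrack f lam)

theorem exists_rep_pow (u : List (Fin N × Bool)) (n : ℕ) :
    ∃ v, IsCyclicallyReduced v ∧
      ConjClasses.mk (mk v) = ConjClasses.map ((f ^ n : MulAut (FreeGroupN N)) :
        FreeGroupN N →* FreeGroupN N) (ConjClasses.mk (mk u)) ∧
      illegalTurns T.legal v ≤ illegalTurns T.legal u := by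
  induction n with
  | zero => exact exists_isCyclicallyReduced T.reduced_of_legal u
  | succ n ih =>
    obtain ⟨v, -, hv, hv'⟩ := ih
    obtain ⟨w, hw, hw', hw''⟩ :=
      exists_isCyclicallyReduced T.reduced_of_legal (v.flatMap T.image)
    refine ⟨w, hw, ?_, hw''.trans ((T.illegalTurns_flatMap_le v).trans hv')⟩
    rw [ConjClasses.map_pow_succ, ← hv, hw', ← T.map_mk_flatMap]
    rfl

theorem exists_len_bounds : ∃ m M : ℝ, 0 < m ∧ 0 < M ∧ ∀ x, m ≤ T.len x ∧ T.len x ≤ M := by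
  obtain ⟨M, hM⟩ := (Set.finite_range T.len).bddAbove
  obtain ⟨K, hK⟩ := (Set.finite_range fun x => (T.len x)⁻¹).bddAbove
  refine ⟨(max K 1)⁻¹, max M 1, by positivity, by positivity, fun x => ⟨?_, ?_⟩⟩
  · exact inv_le_of_inv_le₀ (T.len_pos x) ((hK ⟨x, rfl⟩).trans (le_max_left _ _))
  · exact (hM ⟨x, rfl⟩).trans (le_max_left _ _)

theorem exists_hasLongLegal {c : ConjClasses (FreeGroupN N)} (hc : ¬ IsPeriodicClass f c) (R : ℝ) :
    ∃ n : ℕ, T.HasLongLegal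
      (ConjClasses.map ((f ^ n : MulAut (FreeGroupN N)) : FreeGroupN N →* FreeGroupN N) c) R := by
  obtain ⟨g, rfl⟩ := ConjClasses.exists_rep c
  obtain ⟨u, rfl⟩ : ∃ u, mk u = g := ⟨g.toWord, mk_toWord⟩
  choose v hv hvc hvi using T.exists_rep_pow u
  obtain ⟨m, _, hm, -, hmx⟩ := T.exists_len_bounds
  obtain ⟨B, hB⟩ := exists_nat_ge (R / m)
  have hinj : Function.Injective v := by
    intro i j hij
    by_contra hne
    wlog hlt : i < j generalizing i j
    · exact this hij.symm (Ne.symm hne) (by omega)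
    refine hc ⟨j - i, by omega, ?_⟩
    apply ConjClasses.map_mulAut_injective (f ^ i)
    rw [← ConjClasses.map_pow_add, Nat.add_sub_cancel' hlt.le, ← hvc, ← hvc, hij]
  obtain ⟨n, hn⟩ : ∃ n, (illegalTurns T.legal u + 1) * B < (v n).length := by
    by_contra! h
    refine Set.infinite_range_of_injective hinj ((List.finite_length_le _
      ((illegalTurns T.legal u + 1) * B)).subset ?_)
    rintro _ ⟨n, rfl⟩
    exact h n
  obtain ⟨s, p, t, hs, hp, hpB⟩ := exists_isChain_infix B _ _ (hvi n) hn
  refine ⟨n, p, t ++ s, hp, ?_, ?_, ?_⟩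
  · refine ((hv n).flatten_replicate 2).isReduced.infix ⟨s, t, ?_⟩
    simp [hs, List.replicate]
  · rw [← hvc, hs, ConjClasses.mk_eq_mk_iff_isConj, isConj_iff]
    refine ⟨mk s, ?_⟩
    simp only [← mul_mk]
    group
  · have h1 := T.le_pathLen (fun x => (hmx x).1) p
    have h2 : (B : ℝ) ≤ p.length := by exact_mod_cast hpB.le
    rw [div_le_iff₀ hm] at hB
    nlinarith

theorem exists_hasLongLegal_pow (hlam : 1 < lam) {c : ConjClasses (FreeGroupN N)}
    (hc : ¬ IsPeriodicClass f c) :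
    ∃ n₀ : ℕ, ∀ j : ℕ, T.HasLongLegal (ConjClasses.map ((f ^ (j + n₀) : MulAut (FreeGroupN N)) :
      FreeGroupN N →* FreeGroupN N) c) (lam ^ j) := by
  obtain ⟨C, hC⟩ := bounded_cancellation f
  obtain ⟨_, M, -, hM, hMx⟩ := T.exists_len_bounds
  set D := 4 * C * M with hD
  have hD0 : 0 ≤ D := by positivity
  have hl : 0 < lam - 1 := by linarith
  set E := D / (lam - 1) with hE
  have hE0 : 0 ≤ E := by positivity
  have hE1 : lam * E - D = E := by rw [hE]; field_simp; ring
  obtain ⟨n₀, hn⟩ := T.exists_hasLongLegal hc (1 + E)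
  have key : ∀ j : ℕ, T.HasLongLegal (ConjClasses.map ((f ^ (j + n₀) : MulAut (FreeGroupN N)) :
      FreeGroupN N →* FreeGroupN N) c) (lam ^ j + E) := by
    intro j
    induction j with
    | zero => simpa using hn
    | succ j ih =>
      have hj : 0 < lam ^ j := by positivity
      have := T.hasLongLegal_map hC (fun x => (hMx x).2) hM (by linarith) ih (by nlinarith)
      rw [add_right_comm, ConjClasses.map_pow_succ]
      convert this using 1
      rw [pow_succ']
      linarith
  refine ⟨n₀, fun j => ?_⟩
  obtain ⟨p, q, h1, h2, h3, h4⟩ := key j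
  exact ⟨p, q, h1, h2, h3, by linarith⟩

theorem hasStretchFactor (T : RoseTrainTrack f lam) (hlam : 1 < lam) :
    HasStretchFactor (QuotientGroup.mk f : Out (FreeGroupN N)) lam := by
  intro f' hf' β c hc
  have hpow : ∀ n : ℕ, ConjClasses.map ((f' ^ n : MulAut (FreeGroupN N)) :
      FreeGroupN N →* FreeGroupN N) c = ConjClasses.map ((f ^ n : MulAut (FreeGroupN N)) :
      FreeGroupN N →* FreeGroupN N) c := by
    intro n
    apply ConjClasses.map_eq_of_mk_eq
    exact congrArg (fun x : MulAut (FreeGroupN N) ⧸ Inn (FreeGroupN N) => x ^ n) hf'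
  replace hc : ¬ IsPeriodicClass f c := by
    rintro ⟨k, hk, h⟩
    exact hc ⟨k, hk, by rw [hpow, h]⟩
  simp only [hpow]
  obtain ⟨n₀, hn⟩ := T.exists_hasLongLegal_pow hlam hc
  obtain ⟨m, M, hm, hM, hmM⟩ := T.exists_len_bounds
  obtain ⟨K, hK0, hK⟩ := exists_norm_map_le (β : FreeGroupN N →* FreeGroup (Fin N))
  obtain ⟨K', hK'0, hK'⟩ := exists_norm_map_le (β.symm : FreeGroup (Fin N) →* FreeGroupN N)
  have hl0 : 0 < lam := by linarith
  obtain ⟨g, rfl⟩ := ConjClasses.exists_rep c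
  obtain ⟨u, rfl⟩ : ∃ u, mk u = g := ⟨g.toWord, mk_toWord⟩
  refine tendsto_rpow_one_div_of_bounds hl0 (c := (K' * M * lam ^ n₀)⁻¹)
    (C := K * (|T.pathLen u| + 1) / m) (by positivity) (by positivity) n₀ ?_ ?_
  · intro n hnn
    obtain ⟨j, rfl⟩ := Nat.exists_eq_add_of_le' hnn
    obtain ⟨p, q, hp, hr, hpq, hl⟩ := hn j
    have hp0 : p ≠ [] := by
      rintro rfl
      have : 0 < lam ^ j := by positivity
      simp [pathLen] at hl
      linarith
    have hcr := isCyclicallyReduced_of_append hp0 hr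
    have hne : ((fun g => (β g).norm) '' {g : FreeGroupN N | ConjClasses.mk g =
      ConjClasses.map ((f ^ (j + n₀) : MulAut (FreeGroupN N)) : FreeGroupN N →* FreeGroupN N)
        (ConjClasses.mk (mk u))}).Nonempty := ⟨_, _, hpq, rfl⟩
    obtain ⟨h, hh, hh'⟩ := Nat.sInf_mem hne
    change _ = cycLength β _ at hh'
    rw [← hh']
    have h1 : (p ++ q).length ≤ norm h := by
      apply hcr.length_le_norm
      rw [← ConjClasses.mk_eq_mk_iff_isConj, hpq]
      exact hh
    have h2 : norm h ≤ K' * norm (β h) := by simpa using hK' (β h)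
    have h3 : (p.length : ℝ) ≤ K' * norm (β h) := by
      have : p.length ≤ (p ++ q).length := by simp
      exact_mod_cast this.trans (h1.trans h2)
    have h4 := T.pathLen_le (fun x => (hmM x).2) p
    rw [inv_mul_le_iff₀ (by positivity), pow_add]
    have h5 : lam ^ j ≤ M * (K' * norm (β h)) := hl.trans (h4.trans (by gcongr))
    calc lam ^ j * lam ^ n₀ ≤ M * (K' * norm (β h)) * lam ^ n₀ := by gcongr
      _ = _ := by ring
  · intro n
    have hiter : ∃ w, mk w = (f ^ n) (mk u) ∧ T.pathLen w = lam ^ n * T.pathLen u := by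
      induction n with
      | zero => exact ⟨u, by simp, by simp⟩
      | succ n ih =>
        obtain ⟨w, hw, hw'⟩ := ih
        refine ⟨w.flatMap T.image, ?_, ?_⟩
        · rw [← T.map_mk_flatMap, hw, pow_succ']
          rfl
        · rw [T.pathLen_flatMap, hw']
          ring
    obtain ⟨w, hw, hw'⟩ := hiter
    have h1 : cycLength β (ConjClasses.map ((f ^ n : MulAut (FreeGroupN N)) :
        FreeGroupN N →* FreeGroupN N) (ConjClasses.mk (mk u))) ≤ norm (β ((f ^ n) (mk u))) :=
      Nat.sInf_le ⟨_, rfl, rfl⟩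
    have h2 : norm (β ((f ^ n) (mk u))) ≤ K * w.length := by
      rw [← hw]
      exact (hK (mk w)).trans (Nat.mul_le_mul_left _ norm_mk_le)
    have h3 : (cycLength β (ConjClasses.map ((f ^ n : MulAut (FreeGroupN N)) :
        FreeGroupN N →* FreeGroupN N) (ConjClasses.mk (mk u))) : ℝ) ≤ K * w.length := by
      exact_mod_cast h1.trans h2
    refine h3.trans ?_
    have h4 := T.le_pathLen (fun x => (hmM x).1) w
    rw [hw'] at h4
    have h5 : T.pathLen u ≤ |T.pathLen u| + 1 := by linarith [le_abs_self (T.pathLen u)]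
    have h6 : (w.length : ℝ) ≤ lam ^ n * (|T.pathLen u| + 1) / m := by
      rw [le_div_iff₀ hm, mul_comm]
      exact h4.trans (by gcongr)
    calc (K : ℝ) * w.length ≤ K * (lam ^ n * (|T.pathLen u| + 1) / m) := by gcongr
      _ = _ := by ring

end FreeGroup.RoseTrainTrack

section FreeFactor

variable {G : Type*} [Group G]

/-- Homomorphisms on the two sides of an internal free product decomposition extend uniquely. -/
theorem exists_extend_of_bijective_lift {A B : Subgroup G}
    (h : Function.Bijective (Monoid.Coprod.lift A.subtype B.subtype)) {M : Type*} [Monoid M]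
    (χA : A →* M) (χB : B →* M) : ∃ χ : G →* M, (∀ a : A, χ a = χA a) ∧ ∀ b : B, χ b = χB b := by
  let e := MulEquiv.ofBijective _ h
  have hA : ∀ a : A, e.symm a = Monoid.Coprod.inl a := fun a => by
    rw [MulEquiv.symm_apply_eq]; simp [e]
  have hB : ∀ b : B, e.symm b = Monoid.Coprod.inr b := fun b => by
    rw [MulEquiv.symm_apply_eq]; simp [e]
  exact ⟨(Monoid.Coprod.lift χA χB).comp e.symm.toMonoidHom, fun a => by simp [hA],
    fun b => by simp [hB]⟩

theorem IsFreeGroup.exists_hom_ne_one [IsFreeGroup G] [Nontrivial G] :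
    ∃ (χ : G →* Multiplicative ℚ) (g : G), χ g ≠ 1 := by
  obtain ⟨i⟩ : Nonempty (IsFreeGroup.Generators G) := by
    by_contra hne
    rw [not_nonempty_iff] at hne
    exact not_subsingleton G (IsFreeGroup.toFreeGroup G).toEquiv.subsingleton
  refine ⟨IsFreeGroup.lift fun _ => Multiplicative.ofAdd 1, IsFreeGroup.of i, ?_⟩
  rw [IsFreeGroup.lift_of]
  simp

theorem Subgroup.exists_hom_ne_one [IsFreeGroup G] {A : Subgroup G} (hA : A ≠ ⊥) :
    ∃ (χ : A →* Multiplicative ℚ) (a : A), χ a ≠ 1 := by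
  have : Nontrivial A := A.nontrivial_iff_ne_bot.2 hA
  exact IsFreeGroup.exists_hom_ne_one

/-- A proper nontrivial free factor of a free group has nontrivial rational homology, which
does not fill the rational homology of the whole group. -/
theorem IsFreeFactor.exists_homs [IsFreeGroup G] {A : Subgroup G} (h : IsFreeFactor A)
    (hbot : A ≠ ⊥) (htop : A ≠ ⊤) :
    (∃ χ : G →* Multiplicative ℚ, ∃ a ∈ A, χ a ≠ 1) ∧
      ∃ χ : G →* Multiplicative ℚ, (∀ a ∈ A, χ a = 1) ∧ ∃ g, χ g ≠ 1 := by
  obtain ⟨B, h⟩ := h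
  have hB : B ≠ ⊥ := by
    rintro rfl
    apply htop
    have := Monoid.Coprod.range_lift A.subtype (⊥ : Subgroup G).subtype
    rw [MonoidHom.range_eq_top.2 h.2] at this
    simpa using this.symm
  constructor
  · obtain ⟨χ, a, ha⟩ := Subgroup.exists_hom_ne_one hbot
    obtain ⟨χ', h1, -⟩ := exists_extend_of_bijective_lift h χ 1
    exact ⟨χ', a, a.2, by rwa [h1]⟩
  · obtain ⟨χ, b, hb⟩ := Subgroup.exists_hom_ne_one hB
    obtain ⟨χ', h1, h2⟩ := exists_extend_of_bijective_lift h 1 χ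
    exact ⟨χ', fun a ha => h1 ⟨a, ha⟩, b, by rwa [h2]⟩

end FreeFactor

section CubicField

open Polynomial

theorem exists_plastic_root : ∃ ρ : ℝ, 1 < ρ ∧ ρ ^ 3 = ρ + 1 := by
  obtain ⟨ρ, hρ, h⟩ := intermediate_value_Icc (a := (1 : ℝ)) (b := 2) (by norm_num)
    (f := fun x => x ^ 3 - x - 1) (by fun_prop) (show (0 : ℝ) ∈ _ by norm_num)
  refine ⟨ρ, lt_of_le_of_ne hρ.1 ?_, by simp only at h; linarith⟩
  rintro rfl
  norm_num at h

theorem exists_supergolden_root : ∃ ρ : ℝ, 1 < ρ ∧ ρ ^ 3 = ρ ^ 2 + 1 := by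
  obtain ⟨ρ, hρ, h⟩ := intermediate_value_Icc (a := (1 : ℝ)) (b := 2) (by norm_num)
    (f := fun x => x ^ 3 - x ^ 2 - 1) (by fun_prop) (show (0 : ℝ) ∈ _ by norm_num)
  refine ⟨ρ, lt_of_le_of_ne hρ.1 ?_, by simp only at h; linarith⟩
  rintro rfl
  norm_num at h

instance irreducible_plastic : Fact (Irreducible (X ^ 3 - X - 1 : ℚ[X])) :=
  ⟨X_pow_sub_X_sub_one_irreducible_rat (by norm_num)⟩

/-- The cubic field generated by a root of `X ^ 3 - X - 1`. -/
abbrev PlasticField := AdjoinRoot (X ^ 3 - X - 1 : ℚ[X])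

namespace PlasticField

/-- The distinguished root of `X ^ 3 - X - 1`. -/
noncomputable abbrev root : PlasticField := AdjoinRoot.root _

theorem monic : (X ^ 3 - X - 1 : ℚ[X]).Monic := by monicity!

theorem natDegree : (X ^ 3 - X - 1 : ℚ[X]).natDegree = 3 := by compute_degree!

theorem root_pow_three : root ^ 3 = root + 1 := by
  have := AdjoinRoot.eval₂_root (X ^ 3 - X - 1 : ℚ[X])
  simp only [eval₂_sub, eval₂_pow, eval₂_X, eval₂_one] at this
  linear_combination this

/-- The basis `1, x, x ^ 2` of the cubic field. -/
noncomputable def basis : Module.Basis (Fin 3) ℚ PlasticField :=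
  (AdjoinRoot.powerBasis' monic).basis.reindex (finCongr natDegree)

theorem basis_apply (i : Fin 3) : basis i = root ^ (i : ℕ) := by
  simp [basis]
  rfl

theorem finrank_eq : Module.finrank ℚ PlasticField = 3 := by
  simpa using Module.finrank_eq_card_basis basis

theorem norm_root : Algebra.norm ℚ root = 1 := by
  have h := Algebra.PowerBasis.norm_gen_eq_coeff_zero_minpoly (AdjoinRoot.powerBasis' monic)
  rw [AdjoinRoot.powerBasis'_gen, AdjoinRoot.powerBasis'_dim,
    AdjoinRoot.minpoly_root monic.ne_zero, natDegree] at h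
  convert h using 1
  · congr! 1
  · norm_num [monic.leadingCoeff]

theorem root_pow_ne_algebraMap {k : ℕ} (hk : 0 < k) (q : ℚ) :
    root ^ k ≠ algebraMap ℚ PlasticField q := by
  intro h
  have hq : q ^ 3 = 1 := by
    have := congrArg (Algebra.norm ℚ) h
    rw [map_pow, norm_root, one_pow, Algebra.norm_algebraMap, finrank_eq] at this
    exact this.symm
  have hq1 : q = 1 := by
    have : (q - 1) * ((q + 1 / 2) ^ 2 + 3 / 4) = 0 := by linear_combination hq
    rcases mul_eq_zero.1 this with h | h
    · linarith
    · nlinarith [sq_nonneg (q + 1 / 2)]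
  obtain ⟨ρ, hρ, hρ'⟩ := exists_plastic_root
  let σ : PlasticField →+* ℝ := AdjoinRoot.lift (algebraMap ℚ ℝ) ρ (by
    simp [hρ'])
  have h2 := congrArg σ h
  rw [hq1, map_one, map_one, map_pow, AdjoinRoot.lift_root] at h2
  exact absurd h2 (one_lt_pow₀ hρ hk.ne.symm).ne.symm

/-- No positive power of the root preserves a proper nontrivial rational subspace. -/
theorem eq_bot_or_eq_top {k : ℕ} (hk : 0 < k) (V : Submodule ℚ PlasticField)
    (hV : ∀ v ∈ V, root ^ k * v ∈ V) : V = ⊥ ∨ V = ⊤ := by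
  have := Subalgebra.isSimpleOrder_of_finrank_prime ℚ PlasticField
    (by rw [finrank_eq]; exact Nat.prime_three)
  have hS : ∀ z ∈ Algebra.adjoin ℚ {root ^ k}, ∀ v ∈ V, z * v ∈ V := by
    intro z hz
    induction hz using Algebra.adjoin_induction with
    | mem z hz => rw [Set.mem_singleton_iff.1 hz]; exact hV
    | algebraMap r => intro v hv; rw [← Algebra.smul_def]; exact V.smul_mem r hv
    | add y z _ _ hy hz => intro v hv; rw [add_mul]; exact V.add_mem (hy v hv) (hz v hv)
    | mul y z _ _ hy hz => intro v hv; rw [mul_assoc]; exact hy _ (hz v hv)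
  rcases IsSimpleOrder.eq_bot_or_eq_top (Algebra.adjoin ℚ {root ^ k}) with h | h
  · have := Algebra.self_mem_adjoin_singleton ℚ (root ^ k)
    rw [h] at this
    obtain ⟨q, hq⟩ := Algebra.mem_bot.1 this
    exact absurd hq.symm (root_pow_ne_algebraMap hk q)
  · rw [h] at hS
    refine or_iff_not_imp_left.2 fun hne => ?_
    obtain ⟨v, hv, hv0⟩ := V.ne_bot_iff.1 hne
    refine V.eq_top_iff'.2 fun w => ?_
    have := hS (w / v) Algebra.mem_top v hv
    rwa [div_mul_cancel₀ _ hv0] at this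

end PlasticField

end CubicField

section Example

open FreeGroup

/-- The automorphism `a ↦ b`, `b ↦ c`, `c ↦ ab` of the free group of rank three. -/
def plasticAut : MulAut (FreeGroupN 3) :=
  MonoidHom.toMulEquiv (FreeGroup.lift ![of 1, of 2, of 0 * of 1])
    (FreeGroup.lift ![of 2 * (of 0)⁻¹, of 0, of 1])
    (by ext i; fin_cases i <;> simp) (by ext i; fin_cases i <;> simp)

/-- The homomorphism from the free group of rank three to its rational homology, identified with
the cubic field. -/
noncomputable def plasticHom : FreeGroupN 3 →* Multiplicative PlasticField :=
  FreeGroup.lift fun i => Multiplicative.ofAdd (PlasticField.root ^ (i : ℕ))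

theorem plasticHom_plasticAut (g : FreeGroupN 3) : (plasticHom (plasticAut g)).toAdd =
    PlasticField.root * (plasticHom g).toAdd := by
  let μ : FreeGroupN 3 →* Multiplicative PlasticField :=
    (AddMonoidHom.toMultiplicative (AddMonoidHom.mulLeft PlasticField.root)).comp plasticHom
  have : plasticHom.comp (plasticAut : FreeGroupN 3 →* FreeGroupN 3) = μ := by
    ext i
    apply Multiplicative.toAdd.injective
    fin_cases i
    · simp [μ, plasticHom, plasticAut]
    · simp [μ, plasticHom, plasticAut, pow_two]
    · have := PlasticField.root_pow_three
      simp [μ, plasticHom, plasticAut]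
      change 1 + PlasticField.root = PlasticField.root * PlasticField.root ^ 2
      linear_combination -this
  exact congrArg Multiplicative.toAdd (DFunLike.congr_fun this g)

theorem plasticHom_plasticAut_pow (k : ℕ) (g : FreeGroupN 3) :
    (plasticHom ((plasticAut ^ k) g)).toAdd =
      PlasticField.root ^ k * (plasticHom g).toAdd := by
  induction k with
  | zero => simp
  | succ k ih =>
    rw [pow_succ' plasticAut k, MulAut.mul_apply, plasticHom_plasticAut, ih,
      pow_succ' PlasticField.root k, mul_assoc]

/-- Every rational character factors through the rational homology. -/
theorem exists_linearMap_plasticHom (χ : FreeGroupN 3 →* Multiplicative ℚ) :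
    ∃ ℓ : PlasticField →ₗ[ℚ] ℚ, ∀ g, (χ g).toAdd = ℓ (plasticHom g).toAdd := by
  let ℓ := PlasticField.basis.constr ℚ fun i => (χ (of i)).toAdd
  refine ⟨ℓ, fun g => ?_⟩
  have : χ = (AddMonoidHom.toMultiplicative ℓ.toAddMonoidHom).comp plasticHom := by
    ext i
    apply Multiplicative.toAdd.injective
    simp [plasticHom, ℓ, ← PlasticField.basis_apply]
  exact congrArg Multiplicative.toAdd (DFunLike.congr_fun this g)

theorem fullyIrreducible_plasticAut :
    FullyIrreducible (QuotientGroup.mk plasticAut : Out (FreeGroupN 3)) := by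
  intro k hk f hf A hA hbot htop g hg
  obtain ⟨⟨χ, a, ha, hχa⟩, χ', hχ', b, hb⟩ := hA.exists_homs hbot htop
  obtain ⟨ℓ, hℓ⟩ := exists_linearMap_plasticHom χ
  obtain ⟨ℓ', hℓ'⟩ := exists_linearMap_plasticHom χ'
  have hfh : ∀ x, (plasticHom (f x)).toAdd = PlasticField.root ^ k * (plasticHom x).toAdd := by
    intro x
    obtain ⟨y, hy⟩ := QuotientGroup.eq.1 (show (QuotientGroup.mk (plasticAut ^ k) :
      MulAut (FreeGroupN 3) ⧸ Inn (FreeGroupN 3)) = QuotientGroup.mk f from hf.symm)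
    have : f = plasticAut ^ k * MulAut.conj y := by rw [hy]; group
    rw [this, MulAut.mul_apply, plasticHom_plasticAut_pow]
    simp
  set S : Set PlasticField := (fun x => (plasticHom x).toAdd) '' (A : Set (FreeGroupN 3))
  have hV : ∀ v ∈ Submodule.span ℚ S, PlasticField.root ^ k * v ∈ Submodule.span ℚ S := by
    intro v hv
    induction hv using Submodule.span_induction with
    | mem v hv =>
      obtain ⟨x, hx, rfl⟩ := hv
      have : f x ∈ A.map ((MulAut.conj g : MulAut (FreeGroupN 3)) :
          FreeGroupN 3 →* FreeGroupN 3) := hg ▸ ⟨x, hx, rfl⟩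
      obtain ⟨z, hz, hz'⟩ := this
      refine Submodule.subset_span ⟨z, hz, ?_⟩
      simp only
      rw [← hfh, ← hz']
      simp
    | zero => simp
    | add x y _ _ hx hy => rw [mul_add]; exact Submodule.add_mem _ hx hy
    | smul r x _ hx => rw [mul_smul_comm]; exact Submodule.smul_mem _ _ hx
  rcases PlasticField.eq_bot_or_eq_top hk _ hV with h | h
  · have h0 : (plasticHom a).toAdd = 0 := by
      have : (plasticHom a).toAdd ∈ Submodule.span ℚ S := Submodule.subset_span ⟨a, ha, rfl⟩
      simpa [h] using this
    apply hχa
    apply Multiplicative.toAdd.injective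
    rw [hℓ, h0]
    simp
  · have h0 : ℓ' = 0 := by
      refine LinearMap.ext_on h ?_
      rintro _ ⟨x, hx, rfl⟩
      simp [← hℓ', hχ' x hx]
    apply hb
    apply Multiplicative.toAdd.injective
    rw [hℓ', h0]
    simp

/-- The positive train track map `a ↦ b`, `b ↦ c`, `c ↦ ab`. -/
def plasticTrainTrack {lam : ℝ} (h1 : 1 < lam) (h : lam ^ 3 = lam + 1) :
    RoseTrainTrack plasticAut lam where
  image x := bif x.2 then ![[(1, true)], [(2, true)], [(0, true), (1, true)]] x.1
    else ![[(1, false)], [(2, false)], [(1, false), (0, false)]] x.1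
  legal x y := x.2 = y.2
  len x := lam ^ (x.1 : ℕ)
  map_mk := by
    rintro ⟨i, b⟩
    cases b <;> fin_cases i <;> decide
  isChain_image := by decide
  image_ne_nil := by decide
  legal_image := by decide
  reduced_of_legal _ _ h _ := h
  len_pos x := by positivity
  len_image := by
    rintro ⟨i, b⟩
    cases b <;> fin_cases i <;> simp <;> linarith

/-- The train track map `a ↦ ca⁻¹`, `b ↦ a`, `c ↦ b`. -/
def plasticInvTrainTrack {lam : ℝ} (h1 : 1 < lam) (h : lam ^ 3 = lam ^ 2 + 1) :
    RoseTrainTrack plasticAut⁻¹ lam where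
  image x := bif x.2 then ![[(2, true), (0, false)], [(0, true)], [(1, true)]] x.1
    else ![[(0, true), (2, false)], [(0, false)], [(1, false)]] x.1
  legal x y := (x.2 = true → y.2 = true → y.1 ≠ x.1 + 1) ∧
    (x.2 = false → y.2 = false → x.1 ≠ y.1 + 1) ∧ (x.2 ≠ y.2 → x.1 ≠ y.1)
  len x := ![lam ^ 2, lam, 1] x.1
  map_mk := by
    rintro ⟨i, b⟩
    cases b <;> fin_cases i <;> decide
  isChain_image := by decide
  image_ne_nil := by decide
  legal_image := by decide
  reduced_of_legal := by decide
  len_pos := by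
    rintro ⟨i, b⟩
    fin_cases i <;> simp <;> positivity
  len_image := by
    rintro ⟨i, b⟩
    cases b <;> fin_cases i <;> simp <;> linarith

end Example

/-- There exist `N ≥ 2` and a fully irreducible `φ ∈ Out(F_N)` with
`λ(φ) ≠ λ(φ⁻¹)`. -/
theorem exists_fullyIrreducible_with_different_stretch_factors :
    ∃ N : ℕ, 2 ≤ N ∧
      ∃ φ : Out (FreeGroupN N), FullyIrreducible φ ∧
        ∃ l li : ℝ, HasStretchFactor φ l ∧ HasStretchFactor φ⁻¹ li ∧ l ≠ li := by
  obtain ⟨l, hl, hl'⟩ := exists_plastic_root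
  obtain ⟨m, hm, hm'⟩ := exists_supergolden_root
  refine ⟨3, by norm_num, QuotientGroup.mk plasticAut, fullyIrreducible_plasticAut, l, m,
    (plasticTrainTrack hl hl').hasStretchFactor hl,
    (plasticInvTrainTrack hm hm').hasStretchFactor hm, ?_⟩
  rintro rfl
  nlinarith
end
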